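/- arXiv:1703.09870 — 3 statements merged into one kernel-verified Lean document; each statement's English description precedes it below -/
import Mathlib

section
/- Let 2 ≤ k ≤ m and let A_1, ..., A_n be closed arcs on the circle ℝ/ℤ such that among any m of them, some k have a common point. Then there exists a point of the circle contained in strictly more than (k-1)·n/m of the arcs. -/
open Classical

/-- A closed arc on the circle ℝ/ℤ: the image of a closed interval. -/
def Arc (a b : ℝ) : Set (AddCircle (1 : ℝ)) :=
  (fun t : ℝ => (t : AddCircle (1 : ℝ))) '' Set.Icc a b


/-- number of integer translates of `x` in `[a,c)` -/
noncomputable def cnt (a c x : ℝ) : ℤ := ⌈c - x⌉ - ⌈a - x⌉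

lemma cnt_nonneg {a c x : ℝ} (h : a ≤ c) : 0 ≤ cnt a c x := by
  unfold cnt
  have : ⌈a - x⌉ ≤ ⌈c - x⌉ := Int.ceil_mono (by linarith)
  omega

lemma cnt_shift (p p' x : ℝ) (s : ℤ) : cnt (p - s) (p' - s) x = ⌈p' - x⌉ - ⌈p - x⌉ := by
  unfold cnt
  have h1 : p' - s - x = (p' - x) - s := by ring
  have h2 : p - s - x = (p - x) - s := by ring
  rw [h1, h2, Int.ceil_sub_intCast, Int.ceil_sub_intCast]
  ring

section Sel

variable {n : ℕ}

lemma sum_inv (σ : Equiv.Perm (Fin n)) (S : Finset (Fin n)) (hS : ∀ i, σ i ∈ S ↔ i ∈ S)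
    {M : Type*} [AddCommMonoid M] (f : Fin n → M) : ∑ i ∈ S, f (σ i) = ∑ i ∈ S, f i :=
  Finset.sum_equiv σ (fun i => (hS i).symm) (fun _ _ => rfl)

lemma sum_inv_iter (σ : Equiv.Perm (Fin n)) (S : Finset (Fin n)) (hS : ∀ i, σ i ∈ S ↔ i ∈ S)
    {M : Type*} [AddCommMonoid M] (f : Fin n → M) (t : ℕ) :
    ∑ i ∈ S, f (σ^[t] i) = ∑ i ∈ S, f i := by
  induction t with
  | zero => rfl
  | succ t ih =>
    rw [← ih]
    simp only [Function.iterate_succ_apply]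
    exact sum_inv σ S hS (fun i => f (σ^[t] i))

lemma full_depth (σ : Equiv.Perm (Fin n)) (a : Fin n → ℝ) (d : Fin n → ℤ)
    (S : Finset (Fin n)) (hS : ∀ i, σ i ∈ S ↔ i ∈ S) (x : ℝ) :
    ∑ i ∈ S, cnt (a i) (a (σ i) + d i) x = ∑ i ∈ S, d i := by
  have : ∀ i, cnt (a i) (a (σ i) + d i) x = ⌈a (σ i) - x⌉ + d i - ⌈a i - x⌉ := by
    intro i
    unfold cnt
    have : a (σ i) + d i - x = (a (σ i) - x) + d i := by ring
    rw [this, Int.ceil_add_intCast]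
  simp only [this, Finset.sum_sub_distrib, Finset.sum_add_distrib]
  rw [sum_inv σ S hS (fun i => ⌈a i - x⌉)]
  ring

lemma path_depth (σ : Equiv.Perm (Fin n)) (a : Fin n → ℝ) (d : Fin n → ℤ) (i : Fin n) (m : ℕ)
    (x : ℝ) : ∑ t ∈ Finset.range m, cnt (a (σ^[t] i)) (a (σ (σ^[t] i)) + d (σ^[t] i)) x
      = ⌈a i + ∑ t ∈ Finset.range m, (a (σ (σ^[t] i)) + d (σ^[t] i) - a (σ^[t] i)) - x⌉
        - ⌈a i - x⌉ := by
  have key : ∀ m : ℕ, a i + ∑ t ∈ Finset.range m, (a (σ (σ^[t] i)) + d (σ^[t] i) - a (σ^[t] i))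
      = a (σ^[m] i) + ((∑ t ∈ Finset.range m, d (σ^[t] i) : ℤ) : ℝ) := by
    intro m
    induction m with
    | zero => simp
    | succ m ih =>
      rw [Finset.sum_range_succ, Finset.sum_range_succ, ← add_assoc, ih,
        Function.iterate_succ_apply']
      push_cast
      ring
  induction m with
  | zero => simp
  | succ m ih =>
    rw [Finset.sum_range_succ, ih, key, key]
    have := cnt_shift (a (σ^[m] i) + ((∑ t ∈ Finset.range m, d (σ^[t] i) : ℤ) : ℝ))
      (a (σ^[m+1] i) + ((∑ t ∈ Finset.range (m+1), d (σ^[t] i) : ℤ) : ℝ)) x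
      (∑ t ∈ Finset.range m, d (σ^[t] i))
    have e1 : a (σ^[m] i) + ((∑ t ∈ Finset.range m, d (σ^[t] i) : ℤ) : ℝ)
      - ((∑ t ∈ Finset.range m, d (σ^[t] i) : ℤ) : ℝ) = a (σ^[m] i) := by ring
    have e2 : a (σ^[m+1] i) + ((∑ t ∈ Finset.range (m+1), d (σ^[t] i) : ℤ) : ℝ)
      - ((∑ t ∈ Finset.range m, d (σ^[t] i) : ℤ) : ℝ)
        = a (σ (σ^[m] i)) + d (σ^[m] i) := by
      rw [Finset.sum_range_succ, Function.iterate_succ_apply']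
      push_cast
      ring
    rw [e1, e2] at this
    rw [this]
    ring

/-- orbit of i -/
noncomputable def orb (σ : Equiv.Perm (Fin n)) (i : Fin n) : Finset (Fin n) :=
  (Finset.range (Function.minimalPeriod σ i)).image (fun t => σ^[t] i)

lemma per_pos (σ : Equiv.Perm (Fin n)) (i : Fin n) : 0 < Function.minimalPeriod σ i := by
  apply Function.minimalPeriod_pos_of_mem_periodicPts
  exact Function.Injective.mem_periodicPts σ.injective i

lemma iter_mem_orb (σ : Equiv.Perm (Fin n)) (i : Fin n) (t : ℕ) : σ^[t] i ∈ orb σ i := by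
  rw [← Function.iterate_mod_minimalPeriod_eq]
  exact Finset.mem_image_of_mem _ (Finset.mem_range.2 (Nat.mod_lt _ (per_pos σ i)))

lemma orb_inv (σ : Equiv.Perm (Fin n)) (i : Fin n) : ∀ j, σ j ∈ orb σ i ↔ j ∈ orb σ i := by
  intro j
  constructor
  · intro h
    obtain ⟨t, ht, e⟩ := Finset.mem_image.1 h
    have e2 : σ^[t + Function.minimalPeriod σ i] i = σ j := by
      rw [Function.iterate_add_minimalPeriod_eq, e]
    obtain ⟨p, hp⟩ := Nat.exists_eq_succ_of_ne_zero (per_pos σ i).ne'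
    rw [hp, Nat.add_succ, Function.iterate_succ_apply'] at e2
    rw [← σ.injective e2]
    exact iter_mem_orb σ i _
  · intro h
    obtain ⟨t, ht, e⟩ := Finset.mem_image.1 h
    rw [← e, ← Function.iterate_succ_apply' (f := σ)]
    exact iter_mem_orb σ i _

lemma orb_card (σ : Equiv.Perm (Fin n)) (i : Fin n) :
    (orb σ i).card = Function.minimalPeriod σ i := by
  unfold orb
  rw [Finset.card_image_of_injOn, Finset.card_range]
  intro s hs t ht e
  simp only [Finset.coe_range] at hs ht
  exact Function.iterate_injOn_Iio_minimalPeriod hs ht e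

lemma minper_orb (σ : Equiv.Perm (Fin n)) (i j : Fin n) (h : j ∈ orb σ i) :
    Function.minimalPeriod σ j = Function.minimalPeriod σ i := by
  obtain ⟨t, ht, e⟩ := Finset.mem_image.1 h
  rw [← e]
  exact Function.minimalPeriod_apply_iterate
    (Function.Injective.mem_periodicPts σ.injective i) t

lemma orb_subset (σ : Equiv.Perm (Fin n)) (S : Finset (Fin n)) (hS : ∀ i, σ i ∈ S ↔ i ∈ S)
    (i : Fin n) (hi : i ∈ S) : ∀ t : ℕ, σ^[t] i ∈ S := by
  intro t
  induction t with
  | zero => exact hi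
  | succ t ih => rw [Function.iterate_succ_apply', hS]; exact ih

lemma select_cycle (σ : Equiv.Perm (Fin n)) (a : Fin n → ℝ) (d : Fin n → ℤ)
    (i₀ : Fin n) (r m : ℕ)
    (hm : m ≤ (orb σ i₀).card) (hw : (∑ i ∈ orb σ i₀, d i) * m ≤ r * (orb σ i₀).card) :
    ∃ T ⊆ orb σ i₀, T.card = m ∧ ∀ x, ∑ i ∈ T, cnt (a i) (a (σ i) + d i) x ≤ r := by
  set S := orb σ i₀ with hSdef
  have hS : ∀ i, σ i ∈ S ↔ i ∈ S := orb_inv σ i₀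
  have hne : S.Nonempty := ⟨i₀, iter_mem_orb σ i₀ 0⟩
  let g : Fin n → ℝ := fun i => a (σ i) + d i - a i
  have hsum : ∑ i ∈ S, ∑ t ∈ Finset.range m, g (σ^[t] i) ≤ ∑ i ∈ S, (r : ℝ) := by
    rw [Finset.sum_comm]
    have : ∀ t ∈ Finset.range m, ∑ i ∈ S, g (σ^[t] i) = ((∑ i ∈ S, d i : ℤ) : ℝ) := by
      intro t _
      rw [sum_inv_iter σ S hS]
      simp only [g, Finset.sum_sub_distrib, Finset.sum_add_distrib]
      rw [sum_inv σ S hS a]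
      push_cast
      ring
    rw [Finset.sum_congr rfl this]
    simp only [Finset.sum_const, Finset.card_range, nsmul_eq_mul]
    have h2 : (((∑ i ∈ S, d i) * m : ℤ) : ℝ) ≤ ((r * S.card : ℤ) : ℝ) := by exact_mod_cast hw
    push_cast at h2 ⊢
    linarith
  obtain ⟨i, hi, hle⟩ := Finset.exists_le_of_sum_le hne hsum
  have hinj : Set.InjOn (fun t => σ^[t] i) (Finset.range m : Set ℕ) := by
    intro s hs t ht e
    simp only [Finset.coe_range, Set.mem_Iio] at hs ht
    have hp := minper_orb σ i₀ i hi
    have hc := orb_card σ i₀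
    rw [← hSdef] at hc
    exact Function.iterate_injOn_Iio_minimalPeriod (f := σ) (x := i)
      (by simp only [Set.mem_Iio]; omega) (by simp only [Set.mem_Iio]; omega) e
  refine ⟨(Finset.range m).image (fun t => σ^[t] i), ?_, ?_, ?_⟩
  · intro j hj
    obtain ⟨t, _, rfl⟩ := Finset.mem_image.1 hj
    exact orb_subset σ S hS i hi t
  · rw [Finset.card_image_of_injOn hinj, Finset.card_range]
  · intro x
    rw [Finset.sum_image hinj, path_depth]
    have : ⌈a i + ∑ t ∈ Finset.range m, g (σ^[t] i) - x⌉ ≤ ⌈(a i - x) + (r : ℤ)⌉ := by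
      apply Int.ceil_mono
      push_cast
      linarith
    rw [Int.ceil_add_intCast] at this
    simp only [g] at this
    linarith

lemma select (σ : Equiv.Perm (Fin n)) (a : Fin n → ℝ) (d : Fin n → ℤ)
    (hd : ∀ i, a i ≤ a (σ i) + d i) (N : ℕ) :
    ∀ (S : Finset (Fin n)), S.card = N → (∀ i, σ i ∈ S ↔ i ∈ S) → ∀ (r m : ℕ),
    m ≤ S.card → (∑ i ∈ S, d i) * m ≤ r * S.card →
    ∃ T ⊆ S, T.card = m ∧ ∀ x, ∑ i ∈ T, cnt (a i) (a (σ i) + d i) x ≤ r := by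
  induction N using Nat.strong_induction_on with
  | _ N ih =>
  intro S hN hS r m hm hw
  -- easy subsets
  have easy : ∀ S' ⊆ S, (∀ i, σ i ∈ S' ↔ i ∈ S') → (∑ i ∈ S', d i) ≤ r → m ≤ S'.card →
      ∃ T ⊆ S, T.card = m ∧ ∀ x, ∑ i ∈ T, cnt (a i) (a (σ i) + d i) x ≤ r := by
    intro S' hsub hS' hr hm'
    obtain ⟨T, hT, hc⟩ := Finset.exists_subset_card_eq hm'
    refine ⟨T, hT.trans hsub, hc, fun x => ?_⟩
    calc _ ≤ ∑ i ∈ S', cnt (a i) (a (σ i) + d i) x :=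
          Finset.sum_le_sum_of_subset_of_nonneg hT (fun i _ _ => cnt_nonneg (hd i))
      _ = ∑ i ∈ S', d i := full_depth σ a d S' hS' x
      _ ≤ r := hr
  by_cases hrW : (∑ i ∈ S, d i) ≤ r
  · exact easy S subset_rfl hS hrW hm
  push Not at hrW
  have hne : S.Nonempty := by
    by_contra hcon
    rw [Finset.not_nonempty_iff_eq_empty] at hcon
    subst hcon
    simp at hrW
    omega
  obtain ⟨i₀, hi₀⟩ := hne
  by_cases hC : orb σ i₀ = S
  · obtain ⟨T, h1, h2⟩ := select_cycle σ a d i₀ r m (by rw [hC]; exact hm) (by rw [hC]; exact hw)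
    exact ⟨T, hC ▸ h1, h2⟩
  have hCS : orb σ i₀ ⊆ S := by
    intro j hj
    obtain ⟨t, _, rfl⟩ := Finset.mem_image.1 hj
    exact orb_subset σ S hS i₀ hi₀ t
  have main : ∀ S1 S2 : Finset (Fin n), S1.Nonempty → S2.Nonempty → Disjoint S1 S2 →
      S1 ∪ S2 = S → (∀ i, σ i ∈ S1 ↔ i ∈ S1) → (∀ i, σ i ∈ S2 ↔ i ∈ S2) →
      (∑ i ∈ S1, d i) * S2.card ≤ (∑ i ∈ S2, d i) * S1.card →
      ∃ T ⊆ S, T.card = m ∧ ∀ x, ∑ i ∈ T, cnt (a i) (a (σ i) + d i) x ≤ r := by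
    intro S1 S2 n1 n2 hdis hun i1 i2 hden
    have s1 : S1 ⊆ S := hun ▸ Finset.subset_union_left
    have s2 : S2 ⊆ S := hun ▸ Finset.subset_union_right
    have hcard : S.card = S1.card + S2.card := by rw [← hun, Finset.card_union_of_disjoint hdis]
    have hsum : ∑ i ∈ S, d i = ∑ i ∈ S1, d i + ∑ i ∈ S2, d i := by
      rw [← hun, Finset.sum_union hdis]
    have p1 := n1.card_pos
    have p2 := n2.card_pos
    have W1nn : 0 ≤ ∑ i ∈ S1, d i := by
      rw [← full_depth σ a d S1 i1 0]
      exact Finset.sum_nonneg (fun i _ => cnt_nonneg (hd i))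
    have W2nn : 0 ≤ ∑ i ∈ S2, d i := by
      rw [← full_depth σ a d S2 i2 0]
      exact Finset.sum_nonneg (fun i _ => cnt_nonneg (hd i))
    rw [hsum, hcard] at hw
    rw [hsum] at hrW
    push_cast at hw
    obtain ⟨W1, hW1⟩ : ∃ W1, W1 = ∑ i ∈ S1, d i := ⟨_, rfl⟩
    obtain ⟨W2, hW2⟩ : ∃ W2, W2 = ∑ i ∈ S2, d i := ⟨_, rfl⟩
    obtain ⟨L1, hL1⟩ : ∃ L : ℤ, L = S1.card := ⟨_, rfl⟩
    obtain ⟨L2, hL2⟩ : ∃ L : ℤ, L = S2.card := ⟨_, rfl⟩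
    have q1 : 0 < L1 := by omega
    have q2 : 0 < L2 := by omega
    rw [← hW1, ← hW2, ← hL1, ← hL2] at hw hden
    rw [← hW1, ← hW2] at hrW
    rw [← hW1] at W1nn
    rw [← hW2] at W2nn
    have hm0 : (0:ℤ) ≤ m := by positivity
    have hr0 : (0:ℤ) ≤ r := by positivity
    by_cases hc : (r : ℤ) < W1
    · have k1 : W1 * m ≤ r * L1 := by
        have : (W1 * m) * (L1 + L2) ≤ (r * L1) * (L1 + L2) := by
          have t1 : W1 * L2 * m ≤ W2 * L1 * m := mul_le_mul_of_nonneg_right hden hm0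
          have t2 := mul_le_mul_of_nonneg_right hw q1.le
          nlinarith
        exact le_of_mul_le_mul_right this (by omega)
      have k2 : (m : ℤ) ≤ L1 := by
        have : W1 * m ≤ W1 * L1 := k1.trans (mul_le_mul_of_nonneg_right hc.le q1.le)
        exact le_of_mul_le_mul_left this (by omega)
      obtain ⟨T, h1, h2⟩ := ih S1.card (by omega) S1 rfl i1 r m (by omega)
        (by rw [← hW1, ← hL1]; exact k1)
      exact ⟨T, h1.trans s1, h2⟩
    push Not at hc
    by_cases hmL : m ≤ S1.card
    · exact easy S1 s1 i1 (by omega) hmL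
    push Not at hmL
    have hrr : ((r - W1.toNat : ℕ) : ℤ) = r - W1 := by omega
    have hmm : ((m - S1.card : ℕ) : ℤ) = m - L1 := by omega
    have k3 : W2 * (m - L1) ≤ (r - W1) * L2 := by
      have : (W2 * (m - L1)) * (W1 + W2) ≤ ((r - W1) * L2) * (W1 + W2) := by
        have t1 := mul_le_mul_of_nonneg_left hw W2nn
        have t2 : 0 ≤ (W1 + W2 - r) * (W2 * L1 - W1 * L2) :=
          mul_nonneg (by omega) (by omega)
        nlinarith
      exact le_of_mul_le_mul_right this (by omega)
    obtain ⟨T, h1, h2, h3⟩ := ih S2.card (by omega) S2 rfl i2 (r - W1.toNat) (m - S1.card)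
        (by omega) (by rw [← hW2, ← hL2, hrr, hmm]; exact k3)
    have hdT : Disjoint S1 T := Finset.disjoint_of_subset_right h1 hdis
    refine ⟨S1 ∪ T, Finset.union_subset s1 (h1.trans s2), ?_, fun x => ?_⟩
    · rw [Finset.card_union_of_disjoint hdT]; omega
    · rw [Finset.sum_union hdT, full_depth σ a d S1 i1, ← hW1]
      have := h3 x
      rw [hrr] at this
      linarith
  have nC : (orb σ i₀).Nonempty := ⟨i₀, iter_mem_orb σ i₀ 0⟩
  have nD : (S \ orb σ i₀).Nonempty := by
    rw [Finset.sdiff_nonempty]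
    exact fun h => hC (Finset.Subset.antisymm hCS h)
  have invD : ∀ i, σ i ∈ S \ orb σ i₀ ↔ i ∈ S \ orb σ i₀ := by
    intro i
    rw [Finset.mem_sdiff, Finset.mem_sdiff, hS, orb_inv]
  rcases le_total ((∑ i ∈ orb σ i₀, d i) * (S \ orb σ i₀).card)
    ((∑ i ∈ S \ orb σ i₀, d i) * (orb σ i₀).card) with hle | hle
  · exact main _ _ nC nD Finset.disjoint_sdiff (Finset.union_sdiff_of_subset hCS)
      (orb_inv σ i₀) invD hle
  · exact main _ _ nD nC Finset.sdiff_disjoint (Finset.sdiff_union_of_subset hCS)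
      invD (orb_inv σ i₀) hle

/-- matching ends to starts -/
lemma exists_matching (a c : Fin n → ℝ) (B : ℤ) (hB : ∀ x, ∑ i, cnt (a i) (c i) x ≤ B) :
    ∃ (σ : Equiv.Perm (Fin n)) (d : Fin n → ℤ), (∀ i, c i ≤ a (σ i) + d i) ∧
      ∑ i, d i ≤ B := by
  obtain ⟨M, ⟨x0, hx0⟩, hM⟩ := Int.exists_greatest_of_bdd
    (P := fun z => ∃ x, ∑ i, cnt (a i) (c i) x = z) ⟨B, by rintro z ⟨x, rfl⟩; exact hB x⟩
    ⟨_, 0, rfl⟩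
  let f : ℝ → ℝ := fun y => y - ⌈y - x0⌉
  have f1 : ∀ y, f y ≤ x0 := fun y => by
    have := Int.le_ceil (y - x0); simp only [f]; linarith
  have f2 : ∀ y, x0 - 1 < f y := fun y => by
    have := Int.ceil_lt_add_one (y - x0); simp only [f]; linarith
  have fc : ∀ y t, x0 - 1 < t → t ≤ x0 → ⌈y - t⌉ = ⌈y - x0⌉ + (1 - if f y ≤ t then 1 else 0) := by
    intro y t ht1 ht2
    have e : y - t = (f y - t) + (⌈y - x0⌉ : ℤ) := by simp only [f]; ring
    rw [e, Int.ceil_add_intCast, add_comm]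
    have b1 := f1 y
    have b2 := f2 y
    congr 1
    split_ifs with hh
    · rw [Int.ceil_eq_iff]; push_cast; constructor <;> linarith
    · rw [Int.ceil_eq_iff]; push_cast; constructor <;> linarith
  have count : ∀ t, x0 - 1 < t → t ≤ x0 →
      (Finset.univ.filter (fun i => f (a i) ≤ t)).card
        ≤ (Finset.univ.filter (fun i => f (c i) ≤ t)).card := by
    intro t ht1 ht2
    have h1 := hM _ ⟨t, rfl⟩
    rw [← hx0] at h1
    simp only [cnt, fc _ t ht1 ht2, Finset.sum_sub_distrib, Finset.sum_add_distrib] at h1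
    simp only [Finset.sum_boole] at h1
    have : ((Finset.univ.filter (fun i => f (a i) ≤ t)).card : ℤ)
        ≤ (Finset.univ.filter (fun i => f (c i) ≤ t)).card := by linarith
    exact_mod_cast this
  obtain ⟨τ, hτ, hτ2⟩ := (Finset.all_card_le_biUnion_card_iff_exists_injective
    (fun j : Fin n => Finset.univ.filter (fun i => f (c i) ≤ f (a j)))).1 (by
      intro s
      rcases s.eq_empty_or_nonempty with rfl | hs
      · simp
      obtain ⟨j, hj, hmax⟩ := Finset.exists_max_image s (fun j => f (a j)) hs
      calc s.card ≤ (Finset.univ.filter (fun i => f (a i) ≤ f (a j))).card :=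
            Finset.card_le_card (fun i hi => by simpa using hmax i hi)
        _ ≤ (Finset.univ.filter (fun i => f (c i) ≤ f (a j))).card := count _ (f2 _) (f1 _)
        _ ≤ _ := Finset.card_le_card (Finset.subset_biUnion_of_mem
            (fun j : Fin n => Finset.univ.filter (fun i => f (c i) ≤ f (a j))) hj))
  let e : Equiv.Perm (Fin n) := Equiv.ofBijective τ (Finite.injective_iff_bijective.1 hτ)
  refine ⟨e.symm, fun i => ⌈c i - x0⌉ - ⌈a (e.symm i) - x0⌉, ?_, ?_⟩
  · intro i
    have h1 := hτ2 (e.symm i)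
    have h2 : τ (e.symm i) = i := e.apply_symm_apply i
    rw [h2] at h1
    simp only [Finset.mem_filter, Finset.mem_univ, true_and, f] at h1
    push_cast
    linarith
  · rw [Finset.sum_sub_distrib, Equiv.sum_comp e.symm (fun i => ⌈a i - x0⌉),
      ← Finset.sum_sub_distrib]
    exact hB x0

lemma exists_ends (a b : Fin n → ℝ) (i : Fin n) : ∃ c : ℝ, a i ≤ c ∧ c ≤ a i + 1 ∧
    (b i < c ∨ c = a i + 1) ∧ ∀ j (z : ℤ), a i ≤ a j + z → a j + z < c → a j + z ≤ b i := by
  by_cases h1 : b i < a i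
  · exact ⟨a i, le_rfl, by linarith, Or.inl h1, fun j z h2 h3 => by linarith⟩
  push Not at h1
  by_cases h2 : a i + 1 ≤ b i
  · exact ⟨a i + 1, by linarith, le_rfl, Or.inr rfl, fun j z h3 h4 => by linarith⟩
  push Not at h2
  obtain ⟨j, -, hj⟩ := Finset.exists_min_image Finset.univ
    (fun j => a j + ⌊b i - a j⌋ + 1) ⟨i, Finset.mem_univ i⟩
  have hlt := Int.lt_floor_add_one (b i - a j)
  refine ⟨a j + ⌊b i - a j⌋ + 1, by linarith, ?_, Or.inl (by linarith), ?_⟩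
  · have := hj i (Finset.mem_univ i)
    have h0 : ⌊b i - a i⌋ = 0 := by
      rw [Int.floor_eq_iff]; push_cast; constructor <;> linarith
    rw [h0] at this
    push_cast at this
    linarith
  · intro l z h3 h4
    by_contra hcon
    push Not at hcon
    have h5 := hj l (Finset.mem_univ l)
    have h6 : ⌊b i - a l⌋ < z := by
      rw [Int.floor_lt]; linarith
    have h7 : ((⌊b i - a l⌋ + 1 : ℤ) : ℝ) ≤ z := by exact_mod_cast h6
    push_cast at h7
    linarith

lemma mem_arc {a b x : ℝ} : (x : AddCircle (1:ℝ)) ∈ Arc a b ↔ ∃ z : ℤ, a ≤ x + z ∧ x + z ≤ b := by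
  unfold Arc
  constructor
  · rintro ⟨t, ⟨h1, h2⟩, e⟩
    dsimp only at e
    have e' : ((t - x : ℝ) : AddCircle (1:ℝ)) = 0 := by
      rw [AddCircle.coe_sub, e, sub_self]
    obtain ⟨z, hz⟩ := (AddCircle.coe_eq_zero_iff (1:ℝ)).1 e'
    simp only [zsmul_eq_mul, mul_one] at hz
    exact ⟨z, by linarith, by linarith⟩
  · rintro ⟨z, h1, h2⟩
    refine ⟨x + z, ⟨h1, h2⟩, ?_⟩
    have e' : ((z : ℝ) : AddCircle (1:ℝ)) = 0 :=
      (AddCircle.coe_eq_zero_iff (1:ℝ)).2 ⟨z, by simp⟩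
    simp only [AddCircle.coe_add, e', add_zero]

end Sel

/-- Agreeable Circular Society Theorem (Hardin): in a (k,m)-agreeable circular society of
`n` voters, some platform is approved by strictly more than `(k-1)·n/m` voters. -/
theorem agreeable_circular_society (k m n : ℕ) (hk : 2 ≤ k) (hkm : k ≤ m) (hmn : m ≤ n)
    (a b : Fin n → ℝ)
    (h : ∀ T : Finset (Fin n), T.card = m → ∃ T' ⊆ T, T'.card = k ∧
      (⋂ i ∈ T', Arc (a i) (b i)).Nonempty) :
    ∃ x : AddCircle (1 : ℝ), (((k : ℚ) - 1) * n) / m <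
      ((Finset.univ.filter fun i : Fin n => x ∈ Arc (a i) (b i)).card : ℚ) := by
  by_contra hcon
  push Not at hcon
  choose c hc1 hc2 hc3 hc4 using exists_ends a b
  have hm0 : 0 < m := by omega
  -- depth bound
  have hdepth : ∀ x : ℝ, ∃ y : AddCircle (1:ℝ), ∑ i, cnt (a i) (c i) x ≤
      ((Finset.univ.filter fun i : Fin n => y ∈ Arc (a i) (b i)).card : ℤ) := by
    intro x
    have hle1 : ∀ i, cnt (a i) (c i) x ≤ 1 := by
      intro i
      have : ⌈c i - x⌉ ≤ ⌈(a i - x) + (1 : ℤ)⌉ := Int.ceil_mono (by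
        have := hc2 i; push_cast; linarith)
      rw [Int.ceil_add_intCast] at this
      unfold cnt
      omega
    have hsum : ∑ i, cnt (a i) (c i) x ≤
        ((Finset.univ.filter fun i : Fin n => 0 < cnt (a i) (c i) x).card : ℤ) := by
      rw [← Finset.sum_boole]
      apply Finset.sum_le_sum
      intro i _
      split_ifs with hh
      · exact hle1 i
      · omega
    rcases (Finset.univ.filter fun i : Fin n => 0 < cnt (a i) (c i) x).eq_empty_or_nonempty
      with he | hne
    · rw [he] at hsum
      refine ⟨0, hsum.trans (by simp)⟩
    obtain ⟨j, hj, hmax⟩ := Finset.exists_max_image _ (fun i => a i - ⌈a i - x⌉) hne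
    refine ⟨((a j - ⌈a j - x⌉ : ℝ) : AddCircle (1:ℝ)), hsum.trans ?_⟩
    norm_cast
    apply Finset.card_le_card
    intro i hi
    have h1 := hmax i hi
    have h2 := Int.le_ceil (a j - x)
    simp only [Finset.mem_filter, Finset.mem_univ, true_and] at hi ⊢
    rw [mem_arc]
    have h3 : (⌈a i - x⌉ : ℝ) < c i - x := by
      rw [← Int.lt_ceil]; unfold cnt at hi; omega
    have h4 := hc4 i j (⌈a i - x⌉ - ⌈a j - x⌉) (by push_cast; linarith) (by push_cast; linarith)
    push_cast at h4
    exact ⟨⌈a i - x⌉, by linarith, by linarith⟩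
  have hB : ∀ x : ℝ, ∑ i, cnt (a i) (c i) x ≤ (((k : ℤ) - 1) * n) / m := by
    intro x
    obtain ⟨y, hy⟩ := hdepth x
    refine hy.trans ?_
    rw [Int.le_ediv_iff_mul_le (by exact_mod_cast hm0)]
    have := hcon y
    rw [le_div_iff₀ (by exact_mod_cast hm0)] at this
    exact_mod_cast this
  obtain ⟨σ, d, hσ, hd⟩ := exists_matching a c _ hB
  have hae : ∀ i, a i ≤ a (σ i) + d i := fun i => (hc1 i).trans (hσ i)
  have hk1 : ((k - 1 : ℕ) : ℤ) = k - 1 := by omega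
  obtain ⟨T, -, hT, hTd⟩ := select σ a d hae n Finset.univ (by simp) (by simp) (k - 1) m
    (by simpa using hmn) (by
      rw [hk1, Finset.card_univ, Fintype.card_fin]
      exact (Int.le_ediv_iff_mul_le (by exact_mod_cast hm0)).1 hd)
  obtain ⟨T', hT', hk', x, hx⟩ := h T hT
  obtain ⟨x, rfl⟩ := QuotientAddGroup.mk_surjective x
  have hone : ∀ i ∈ T', 1 ≤ cnt (a i) (a (σ i) + d i) x := by
    intro i hi
    have h1 := Set.mem_iInter₂.1 hx i hi
    obtain ⟨z, h2, h3⟩ := mem_arc.1 h1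
    have h4 : ⌈c i - x⌉ ≤ ⌈a (σ i) + d i - x⌉ := Int.ceil_mono (by linarith [hσ i])
    have h5 : ⌈a i - x⌉ < ⌈c i - x⌉ := by
      rcases hc3 i with h6 | h6
      · have h7 : ⌈a i - x⌉ ≤ z := Int.ceil_le.2 (by linarith)
        have h8 : z < ⌈c i - x⌉ := Int.lt_ceil.2 (by linarith)
        omega
      · have : c i - x = (a i - x) + (1 : ℤ) := by rw [h6]; push_cast; ring
        rw [this, Int.ceil_add_intCast]
        omega
    unfold cnt
    omega
  have h1 : (k : ℤ) ≤ ∑ i ∈ T', cnt (a i) (a (σ i) + d i) x := by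
    rw [← hk']
    have := Finset.sum_le_sum hone
    simpa using this
  have h2 : ∑ i ∈ T', cnt (a i) (a (σ i) + d i) x ≤ ∑ i ∈ T, cnt (a i) (a (σ i) + d i) x :=
    Finset.sum_le_sum_of_subset_of_nonneg hT' (fun i _ _ => cnt_nonneg (hae i))
  have h3 := hTd x
  omega
end

section
/- Let 2 ≤ k ≤ m and let C_1, ..., C_n be subsets of ℝ × (ℝ/ℤ) of the form I_i × J_i where I_i is a closed bounded interval in ℝ and J_i is a closed arc in ℝ/ℤ, such that among any m of them, some k share a common point. If n ≥ m(m-1)/(k-1), then there is a point contained in strictly more than (k-1)²/(m(m-1)) · n of the sets C_i. -/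
open Classical

/-- Periodic sorted enumeration of the lifts of `f`. -/
theorem lift_exists {n : ℕ} (hn : 0 < n) (f : Fin n → ℝ) :
    ∃ (idx : ℤ → Fin n) (r : ℤ → ℤ), Monotone (fun j => f (idx j) + (r j : ℝ)) ∧
      ∀ J : ℤ, Function.Bijective (fun t : Fin n => idx (J + (t : ℕ))) ∧
        ∑ t : Fin n, r (J + (t : ℕ)) = J - ∑ i, ⌊f i⌋ := by
  have hn' : (0 : ℤ) < n := by exact_mod_cast hn
  let σ := Tuple.sort (fun i => Int.fract (f i))
  have hσ : Monotone ((fun i => Int.fract (f i)) ∘ σ) := Tuple.monotone_sort _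
  have hlt : ∀ j : ℤ, (j % n).toNat < n := by
    intro j
    have := Int.emod_lt_of_pos j hn'
    have := Int.emod_nonneg j hn'.ne'
    omega
  let idx : ℤ → Fin n := fun j => σ ⟨(j % n).toNat, hlt j⟩
  let r : ℤ → ℤ := fun j => j / n - ⌊f (idx j)⌋
  have hbij : ∀ J : ℤ, Function.Bijective (fun t : Fin n => idx (J + (t : ℕ))) := by
    intro J
    refine Finite.injective_iff_bijective.1 ?_
    intro t t' h
    have h1 := σ.injective h
    have h2 : ((J + (t:ℕ)) % n).toNat = ((J + (t':ℕ)) % n).toNat := by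
      simpa using congrArg Fin.val h1
    have a1 := Int.emod_nonneg (J + (t:ℕ)) hn'.ne'
    have a2 := Int.emod_nonneg (J + (t':ℕ)) hn'.ne'
    have h3 : (J + (t:ℕ)) % n = (J + (t':ℕ)) % n := by omega
    have h4 : (n : ℤ) ∣ (t : ℕ) - (t' : ℕ) := by
      have := Int.emod_emod_of_dvd
      have h5 := Int.sub_emod (J + (t:ℕ)) (J + (t':ℕ)) n
      rw [h3] at h5
      have : (n:ℤ) ∣ (J + (t:ℕ)) - (J + (t':ℕ)) := by
        apply Int.dvd_of_emod_eq_zero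
        rw [h5]; simp
      simpa using this
    have b1 := t.2
    have b2 := t'.2
    have h6 : ((t : ℕ) : ℤ) - (t' : ℕ) = 0 := by
      apply Int.eq_zero_of_abs_lt_dvd h4
      rw [abs_lt]; constructor <;> omega
    apply Fin.ext
    omega
  refine ⟨idx, r, ?_, ?_⟩
  · have key : ∀ j, f (idx j) + (r j : ℝ) = Int.fract (f (idx j)) + ((j / n : ℤ) : ℝ) := by
      intro j
      simp only [r, Int.fract]
      push_cast
      ring
    intro j j' hjj
    simp only [key]
    have hdiv : j / n ≤ j' / n := Int.ediv_le_ediv hn' hjj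
    rcases hdiv.lt_or_eq with hd | hd
    · have : ((j / n : ℤ) : ℝ) + 1 ≤ ((j' / n : ℤ) : ℝ) := by exact_mod_cast hd
      have := Int.fract_lt_one (f (idx j))
      have := Int.fract_nonneg (f (idx j'))
      linarith
    · rw [hd]
      have e1 := Int.emod_add_mul_ediv j n
      have e2 := Int.emod_add_mul_ediv j' n
      rw [hd] at e1
      have : (⟨(j % n).toNat, hlt j⟩ : Fin n) ≤ ⟨(j' % n).toNat, hlt j'⟩ := by
        rw [Fin.mk_le_mk]
        omega
      have := hσ this
      simp only [Function.comp] at this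
      simpa [idx] using this
  · intro J
    refine ⟨hbij J, ?_⟩
    have h1 : ∑ t : Fin n, ⌊f (idx (J + (t:ℕ)))⌋ = ∑ i, ⌊f i⌋ :=
      (hbij J).sum_comp (fun i => ⌊f i⌋)
    simp only [r]
    rw [Finset.sum_sub_distrib, h1]
    congr 1
    rw [Fin.sum_univ_eq_sum_range (fun t => (J + (t:ℤ)) / (n:ℤ))]
    have step : ∀ J : ℤ, ∑ t ∈ Finset.range n, ((J + 1) + (t:ℤ)) / (n:ℤ)
        = ∑ t ∈ Finset.range n, (J + (t:ℤ)) / (n:ℤ) + 1 := by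
      intro J
      have s1 := Finset.sum_range_succ (fun t : ℕ => (J + (t:ℤ)) / (n:ℤ)) n
      have s2 := Finset.sum_range_succ' (fun t : ℕ => (J + (t:ℤ)) / (n:ℤ)) n
      have s3 : (J + (n:ℤ)) / (n:ℤ) = J / n + 1 := by
        rw [Int.add_ediv_of_dvd_right (dvd_refl _), Int.ediv_self hn'.ne']
      have s4 : ∑ t ∈ Finset.range n, ((J + 1) + (t:ℤ)) / (n:ℤ)
          = ∑ t ∈ Finset.range n, (J + ((t + 1 : ℕ):ℤ)) / (n:ℤ) := by
        apply Finset.sum_congr rfl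
        intro t _
        congr 1
        push_cast; ring
      simp only [Nat.cast_zero, add_zero] at s2
      rw [s4]
      linarith
    clear h1
    induction J using Int.induction_on with
    | zero =>
      apply Finset.sum_eq_zero
      intro t ht
      rw [zero_add]
      apply Int.ediv_eq_zero_of_lt (by positivity)
      exact_mod_cast Finset.mem_range.1 ht
    | succ i ih => rw [step, ih]
    | pred i ih =>
      have := step (-(i:ℤ) - 1)
      rw [sub_add_cancel, ih] at this
      linarith

/-- FIFO matching of right ends to left ends. -/
theorem matching_exists {n : ℕ} (hn : 0 < n) (c D : Fin n → ℝ) (ω : ℤ)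
    (hω : ∀ j, ∑ i, (⌈D i - c j⌉ - ⌈c i - c j⌉) ≤ ω) :
    ∃ (τ : Equiv.Perm (Fin n)) (e : Fin n → ℤ), (∀ i, D i ≤ c (τ i) + e i) ∧ ∑ i, e i = ω := by
  obtain ⟨p, r, hC, hC'⟩ := lift_exists hn c
  obtain ⟨q, u, hD, hD'⟩ := lift_exists hn D
  set s : ℤ := ω + ∑ i, ⌊c i⌋ - ∑ i, ⌊D i⌋ with hs
  have main : ∀ j : ℤ, D (q j) + u j ≤ c (p (j + s)) + r (j + s) := by
    intro j
    by_contra hlt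
    push Not at hlt
    set x : ℝ := c (p (j + s)) + r (j + s) with hx
    have h1 : (∑ i, ⌊D i⌋) - j + n ≤ ∑ i, ⌈D i - x⌉ := by
      rw [← (hD' j).1.sum_comp (fun i => ⌈D i - x⌉)]
      have : ∑ t : Fin n, (1 - u (j + (t:ℕ))) ≤ ∑ t : Fin n, ⌈D (q (j + (t:ℕ))) - x⌉ := by
        apply Finset.sum_le_sum
        intro t _
        have hm := hD (show j ≤ j + (t:ℕ) by omega)
        simp only at hm
        have : -u (j + (t:ℕ)) < ⌈D (q (j + (t:ℕ))) - x⌉ := by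
          rw [Int.lt_ceil]
          push_cast
          linarith
        linarith
      rw [Finset.sum_sub_distrib, (hD' j).2] at this
      simp at this
      linarith
    have h2 : ∑ i, ⌈c i - x⌉ ≤ (∑ i, ⌊c i⌋) - (j + s - n + 1) := by
      rw [← (hC' (j + s - n + 1)).1.sum_comp (fun i => ⌈c i - x⌉)]
      have : ∑ t : Fin n, ⌈c (p (j + s - n + 1 + (t:ℕ))) - x⌉
          ≤ ∑ t : Fin n, -r (j + s - n + 1 + (t:ℕ)) := by
        apply Finset.sum_le_sum
        intro t _
        have hm := hC (show j + s - n + 1 + (t:ℕ) ≤ j + s by have := t.2; omega)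
        simp only at hm
        rw [Int.ceil_le]
        push_cast
        linarith
      rw [Finset.sum_neg_distrib, (hC' (j + s - n + 1)).2] at this
      linarith
    have h3 := hω (p (j + s))
    have h4 : ∑ i, (⌈D i - c (p (j+s))⌉ - ⌈c i - c (p (j+s))⌉) = ∑ i, ⌈D i - x⌉ - ∑ i, ⌈c i - x⌉ := by
      rw [← Finset.sum_sub_distrib]
      apply Finset.sum_congr rfl
      intro i _
      have e1 : D i - c (p (j+s)) = (D i - x) + (r (j+s) : ℤ) := by rw [hx]; ring
      have e2 : c i - c (p (j+s)) = (c i - x) + (r (j+s) : ℤ) := by rw [hx]; ring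
      rw [e1, e2, Int.ceil_add_intCast, Int.ceil_add_intCast]
      ring
    linarith
  let P := Equiv.ofBijective _ (hD' 0).1
  let Q := Equiv.ofBijective _ (hC' s).1
  refine ⟨P.symm.trans Q, fun i => r (s + (P.symm i : ℕ)) - u (0 + (P.symm i : ℕ)), ?_, ?_⟩
  · intro i
    obtain ⟨t, rfl⟩ := P.surjective i
    have := main (0 + (t:ℕ))
    have e1 : (0 : ℤ) + (t:ℕ) + s = s + (t:ℕ) := by ring
    rw [e1] at this
    have e2 : P t = q (0 + (t:ℕ)) := rfl
    have e3 : Q t = p (s + (t:ℕ)) := rfl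
    simp only [Equiv.trans_apply, Equiv.symm_apply_apply]
    rw [e2, e3]
    push_cast
    linarith
  · rw [← P.sum_comp]
    simp only [Equiv.symm_apply_apply]
    rw [Finset.sum_sub_distrib, (hC' s).2, (hD' 0).2]
    omega

/-- Winding selection. -/
theorem selection {N : ℕ} (τ : Equiv.Perm (Fin N)) (e : Fin N → ℤ) (c : Fin N → ℝ)
    (hpos : ∀ i, c i ≤ c (τ i) + e i) :
    ∀ (s : ℕ) (S : Finset (Fin N)), S.card = s → (∀ i ∈ S, τ i ∈ S) → ∀ (v : ℤ) (m : ℕ), 0 ≤ v →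
      (m : ℤ) * ∑ i ∈ S, e i ≤ S.card * v → m ≤ S.card →
      ∃ T ⊆ S, T.card = m ∧ ∀ x : ℝ, ∑ i ∈ T, (⌈c (τ i) + e i - x⌉ - ⌈c i - x⌉) ≤ v := by
  have hN : ∀ i x, 0 ≤ ⌈c (τ i) + e i - x⌉ - ⌈c i - x⌉ := by
    intro i x
    have : ⌈c i - x⌉ ≤ ⌈c (τ i) + e i - x⌉ := Int.ceil_mono (by linarith [hpos i])
    linarith
  have hperm : ∀ S : Finset (Fin N), (∀ i ∈ S, τ i ∈ S) → ∀ {M : Type} [AddCommMonoid M]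
      (g : Fin N → M), ∑ i ∈ S, g (τ i) = ∑ i ∈ S, g i := by
    intro S hS M _ g
    have him : S.image τ = S := by
      apply Finset.eq_of_subset_of_card_le
      · intro y hy
        obtain ⟨i, hi, rfl⟩ := Finset.mem_image.1 hy
        exact hS i hi
      · rw [Finset.card_image_of_injective _ τ.injective]
    conv_rhs => rw [← him]
    rw [Finset.sum_image (fun a _ b _ h => τ.injective h)]
  have hwind : ∀ S : Finset (Fin N), (∀ i ∈ S, τ i ∈ S) → ∀ x : ℝ,
      ∑ i ∈ S, (⌈c (τ i) + e i - x⌉ - ⌈c i - x⌉) = ∑ i ∈ S, e i := by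
    intro S hS x
    have : ∀ i ∈ S, ⌈c (τ i) + e i - x⌉ - ⌈c i - x⌉ = (⌈c (τ i) - x⌉ - ⌈c i - x⌉) + e i := by
      intro i _
      have : c (τ i) + e i - x = (c (τ i) - x) + (e i : ℤ) := by ring
      rw [this, Int.ceil_add_intCast]; ring
    rw [Finset.sum_congr rfl this, Finset.sum_add_distrib, Finset.sum_sub_distrib,
      hperm S hS (fun i => ⌈c i - x⌉)]
    ring
  have hsub : ∀ (T S : Finset (Fin N)), T ⊆ S → ∀ x : ℝ,
      ∑ i ∈ T, (⌈c (τ i) + e i - x⌉ - ⌈c i - x⌉) ≤ ∑ i ∈ S, (⌈c (τ i) + e i - x⌉ - ⌈c i - x⌉) :=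
    fun T S h x => Finset.sum_le_sum_of_subset_of_nonneg h (fun i _ _ => hN i x)
  intro s
  induction s using Nat.strong_induction_on with
  | _ s ih =>
  intro S hs hS v m hv hm hmS
  by_cases hbig : ∑ i ∈ S, e i ≤ v
  · obtain ⟨T, hT, hTc⟩ := Finset.exists_subset_card_eq hmS
    exact ⟨T, hT, hTc, fun x => (hsub T S hT x).trans ((hwind S hS x).le.trans hbig)⟩
  push Not at hbig
  by_cases hprop : ∃ Z ⊆ S, Z.Nonempty ∧ Z ≠ S ∧ ∀ i ∈ Z, τ i ∈ Z
  · -- two complementary invariant pieces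
    have two : ∀ A B : Finset (Fin N), Disjoint A B → A ∪ B = S → A.card < s → B.card < s →
        (∀ i ∈ A, τ i ∈ A) → (∀ i ∈ B, τ i ∈ B) →
        (B.card : ℤ) * ∑ i ∈ A, e i ≤ A.card * ∑ i ∈ B, e i →
        ∃ T ⊆ S, T.card = m ∧ ∀ x : ℝ, ∑ i ∈ T, (⌈c (τ i) + e i - x⌉ - ⌈c i - x⌉) ≤ v := by
      intro A B hAB hU hAs hBs hA hB hdens
      have hwS : ∑ i ∈ S, e i = ∑ i ∈ A, e i + ∑ i ∈ B, e i := by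
        rw [← hU, Finset.sum_union hAB]
      have hcS : S.card = A.card + B.card := by rw [← hU, Finset.card_union_of_disjoint hAB]
      have hAS : A ⊆ S := hU ▸ Finset.subset_union_left
      have hBS : B ⊆ S := hU ▸ Finset.subset_union_right
      have hA0 : 0 ≤ ∑ i ∈ A, e i := by
        rw [← hwind A hA 0]; exact Finset.sum_nonneg (fun i _ => hN i 0)
      have hB0 : 0 ≤ ∑ i ∈ B, e i := by
        rw [← hwind B hB 0]; exact Finset.sum_nonneg (fun i _ => hN i 0)
      rw [hwS] at hm hbig
      rw [hcS] at hm hmS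
      push_cast at hm
      generalize hw : ∑ i ∈ A, e i = w at *
      generalize hw' : ∑ i ∈ B, e i = w' at *
      have hωpos : 0 < w + w' := by linarith
      by_cases hwv : w ≤ v
      · by_cases hmA : m ≤ A.card
        · obtain ⟨T, hT, hTc⟩ := Finset.exists_subset_card_eq hmA
          refine ⟨T, hT.trans hAS, hTc, fun x => ?_⟩
          have := hsub T A hT x
          rw [hwind A hA x] at this
          linarith
        · push Not at hmA
          obtain ⟨T, hT, hTc, hTx⟩ := ih B.card hBs B rfl hB (v - w) (m - A.card) (by linarith)
            (by
              rw [hw', Nat.cast_sub hmA.le]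
              refine le_of_mul_le_mul_right ?_ hωpos
              nlinarith [mul_nonneg (sub_nonneg.2 hbig.le) (sub_nonneg.2 hdens),
                mul_le_mul_of_nonneg_right hm hB0]) (by omega)
          have hd : Disjoint A T := Finset.disjoint_of_subset_right hT hAB
          refine ⟨A ∪ T, Finset.union_subset hAS (hT.trans hBS), ?_, fun x => ?_⟩
          · rw [Finset.card_union_of_disjoint hd, hTc]; omega
          · rw [Finset.sum_union hd, hwind A hA x]
            linarith [hTx x]
      · push Not at hwv
        have hwpos : 0 < w := by linarith
        have key : (m : ℤ) * w ≤ A.card * v := by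
          refine le_of_mul_le_mul_right ?_ hωpos
          nlinarith [mul_le_mul_of_nonneg_right hm hA0, mul_le_mul_of_nonneg_right hdens hv]
        obtain ⟨T, hT, hTc, hTx⟩ := ih A.card hAs A rfl hA v m hv (by rw [hw]; exact key)
          (by
            have : (m : ℤ) * w ≤ A.card * w :=
              key.trans (mul_le_mul_of_nonneg_left hwv.le (by positivity))
            exact_mod_cast le_of_mul_le_mul_right this hwpos)
        exact ⟨T, hT.trans hAS, hTc, hTx⟩
    obtain ⟨Z, hZS, hZne, hZneq, hZ⟩ := hprop
    have hZlt : Z.card < S.card := Finset.card_lt_card (hZS.ssubset_of_ne hZneq)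
    have hZpos := hZne.card_pos
    have hc : (S \ Z).card = S.card - Z.card := Finset.card_sdiff_of_subset hZS
    have hZ' : ∀ i ∈ S \ Z, τ i ∈ S \ Z := by
      intro i hi
      rw [Finset.mem_sdiff] at hi ⊢
      refine ⟨hS i hi.1, fun h => hi.2 ?_⟩
      have him : Z.image τ = Z := by
        apply Finset.eq_of_subset_of_card_le
        · intro y hy
          obtain ⟨i, hi, rfl⟩ := Finset.mem_image.1 hy
          exact hZ i hi
        · rw [Finset.card_image_of_injective _ τ.injective]
      rw [← him] at h
      obtain ⟨y, hy, hye⟩ := Finset.mem_image.1 h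
      rwa [← τ.injective hye]
    rcases le_total (((S \ Z).card : ℤ) * ∑ i ∈ Z, e i) (Z.card * ∑ i ∈ S \ Z, e i) with h | h
    · exact two Z (S \ Z) Finset.disjoint_sdiff (Finset.union_sdiff_of_subset hZS) (by omega)
        (by omega) hZ hZ' h
    · exact two (S \ Z) Z Finset.sdiff_disjoint (Finset.sdiff_union_of_subset hZS) (by omega)
        (by omega) hZ' hZ h
  · push Not at hprop
    have hSne : S.Nonempty := by
      rw [Finset.nonempty_iff_ne_empty]
      rintro rfl
      simp at hbig
      omega
    have hit : ∀ i ∈ S, ∀ j : ℕ, (τ^[j]) i ∈ S := by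
      intro i hi j
      induction j with
      | zero => exact hi
      | succ j ihj => rw [Function.iterate_succ_apply']; exact hS _ ihj
    have hper : ∀ i ∈ S, ∀ p : ℕ, 0 < p → (τ^[p]) i = i → S.card ≤ p := by
      intro i hi p hp hpi
      by_contra hlt
      push Not at hlt
      obtain ⟨y, hy, hy'⟩ := hprop ((Finset.range p).image (fun j => (τ^[j]) i))
        (by intro y hy
            obtain ⟨j, _, rfl⟩ := Finset.mem_image.1 hy
            exact hit i hi j)
        ⟨i, Finset.mem_image.2 ⟨0, by simpa using hp, rfl⟩⟩
        (by intro h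
            have := Finset.card_image_le (s := Finset.range p) (f := fun j => (τ^[j]) i)
            rw [h, Finset.card_range] at this
            omega)
      apply hy'
      obtain ⟨j, hj, rfl⟩ := Finset.mem_image.1 hy
      rw [Finset.mem_range] at hj
      rw [Finset.mem_image]
      by_cases hjp : j + 1 < p
      · exact ⟨j + 1, by simpa using hjp, by simp only [Function.iterate_succ_apply']⟩
      · refine ⟨0, by simpa using hp, ?_⟩
        have : j + 1 = p := by omega
        have h9 := Function.iterate_succ_apply' (⇑τ) j i
        rw [Nat.succ_eq_add_one, this, hpi] at h9
        exact h9
    have hinj : ∀ i ∈ S, Set.InjOn (fun j => (τ^[j]) i) (Finset.range m : Set ℕ) := by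
      intro i hi
      have aux : ∀ j j', j < j' → j' < m → (τ^[j]) i ≠ (τ^[j']) i := by
        intro j j' h1 h2 h3
        obtain ⟨p, rfl⟩ := Nat.exists_eq_add_of_lt h1
        have : (τ^[j]) i = (τ^[j]) ((τ^[p+1]) i) := by
          rw [← Function.iterate_add_apply, h3, add_assoc]
        have := (τ.injective.iterate j) this
        have := hper i hi (p+1) (by omega) this.symm
        omega
      intro j hj j' hj' h
      have hj : j < m := by simpa using hj
      have hj' : j' < m := by simpa using hj'
      rcases lt_trichotomy j j' with h1 | h1 | h1
      · exact absurd h (aux _ _ h1 hj')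
      · exact h1
      · exact absurd h.symm (aux _ _ h1 hj)
    -- averaging
    have hitsum : ∀ (M : Type) [AddCommMonoid M] (g : Fin N → M) (j : ℕ),
        ∑ i ∈ S, g ((τ^[j]) i) = ∑ i ∈ S, g i := by
      intro M _ g j
      induction j with
      | zero => rfl
      | succ j ihj =>
        rw [← ihj, ← hperm S hS (fun i => g ((τ^[j]) i))]
        rfl
    have havg : ∃ i ∈ S, c ((τ^[m]) i) + (∑ j ∈ Finset.range m, e ((τ^[j]) i) : ℤ) - c i ≤ v := by
      apply Finset.exists_le_of_sum_le hSne
      rw [Finset.sum_sub_distrib, Finset.sum_add_distrib, hitsum ℝ c m]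
      have : ∑ i ∈ S, ((∑ j ∈ Finset.range m, e ((τ^[j]) i) : ℤ) : ℝ)
          = ((m * ∑ i ∈ S, e i : ℤ) : ℝ) := by
        rw [← Int.cast_sum, Finset.sum_comm]
        congr 1
        rw [Finset.sum_congr rfl (fun j _ => hitsum ℤ e j)]
        simp
      rw [this]
      have h2 : ((m * ∑ i ∈ S, e i : ℤ) : ℝ) ≤ ((S.card * v : ℤ) : ℝ) := by exact_mod_cast hm
      simp only [Finset.sum_const, nsmul_eq_mul]
      push_cast at h2 ⊢
      linarith
    obtain ⟨i, hi, hiv⟩ := havg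
    refine ⟨(Finset.range m).image (fun j => (τ^[j]) i), ?_, ?_, ?_⟩
    · intro y hy
      obtain ⟨j, _, rfl⟩ := Finset.mem_image.1 hy
      exact hit i hi j
    · rw [Finset.card_image_of_injOn (hinj i hi), Finset.card_range]
    · intro x
      rw [Finset.sum_image (hinj i hi)]
      have tele : ∀ q : ℕ, ∑ j ∈ Finset.range q,
          (⌈c (τ ((τ^[j]) i)) + e ((τ^[j]) i) - x⌉ - ⌈c ((τ^[j]) i) - x⌉)
          = ⌈c ((τ^[q]) i) + (∑ j ∈ Finset.range q, e ((τ^[j]) i) : ℤ) - x⌉ - ⌈c i - x⌉ := by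
        intro q
        induction q with
        | zero => simp
        | succ q ihq =>
          rw [Finset.sum_range_succ, ihq, Finset.sum_range_succ, Function.iterate_succ_apply']
          generalize ∑ j ∈ Finset.range q, e ((τ^[j]) i) = E
          generalize (τ^[q]) i = y
          have e1 : c y + (E : ℝ) - x = (c y - x) + (E : ℤ) := by ring
          have e2 : c (τ y) + ((E + e y : ℤ) : ℝ) - x = (c (τ y) + e y - x) + (E : ℤ) := by
            push_cast; ring
          rw [e1, e2, Int.ceil_add_intCast, Int.ceil_add_intCast]
          ring
      rw [tele]
      have : ⌈c ((τ^[m]) i) + (∑ j ∈ Finset.range m, e ((τ^[j]) i) : ℤ) - x⌉ ≤ ⌈(c i - x) + (v : ℤ)⌉ :=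
        Int.ceil_mono (by linarith)
      rw [Int.ceil_add_intCast] at this
      linarith

theorem mem_Arc_iff (c d x : ℝ) :
    (x : AddCircle (1:ℝ)) ∈ Arc c d ↔ ∃ t : ℤ, c ≤ x + t ∧ x + t ≤ d := by
  constructor
  · rintro ⟨y, hy, hyx⟩
    have h0 : ((y - x : ℝ) : AddCircle (1:ℝ)) = 0 := by
      rw [AddCircle.coe_sub]; exact sub_eq_zero.2 hyx
    obtain ⟨t, ht⟩ := (AddCircle.coe_eq_zero_iff (1:ℝ)).1 h0
    refine ⟨t, ?_⟩
    have : x + t = y := by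
      simp at ht; linarith
    rw [this]; exact hy
  · rintro ⟨t, h1, h2⟩
    refine ⟨x + t, ⟨h1, h2⟩, ?_⟩
    have : ((t : ℝ) : AddCircle (1:ℝ)) = 0 :=
      (AddCircle.coe_eq_zero_iff (1:ℝ)).2 ⟨t, by simp⟩
    simp only [AddCircle.coe_add, this, add_zero]

theorem end_exists {N : ℕ} (c : Fin N → ℝ) (i : Fin N) (d : ℝ) :
    ∃ D : ℝ, c i ≤ D ∧
      (∀ x : ℝ, (x : AddCircle (1:ℝ)) ∈ Arc (c i) d → 1 ≤ ⌈D - x⌉ - ⌈c i - x⌉) ∧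
      (∀ j, ⌈D - c j⌉ - ⌈c i - c j⌉ ≤ if (c j : AddCircle (1:ℝ)) ∈ Arc (c i) d then 1 else 0) := by
  by_cases hd : d < c i
  · refine ⟨c i, le_rfl, ?_, ?_⟩
    · intro x hx
      obtain ⟨t, h1, h2⟩ := (mem_Arc_iff _ _ _).1 hx
      linarith
    · intro j
      rw [sub_self]
      split_ifs <;> simp
  push Not at hd
  have hne : (Finset.univ : Finset (Fin N)).Nonempty := ⟨i, Finset.mem_univ i⟩
  let I := Finset.univ.inf' hne (fun j => c j + (⌊d - c j⌋ : ℝ) + 1)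
  have hI : ∀ j, I ≤ c j + (⌊d - c j⌋ : ℝ) + 1 := fun j => Finset.inf'_le _ (Finset.mem_univ j)
  have hdI : d < I := by
    rw [Finset.lt_inf'_iff]
    intro j _
    have := Int.lt_floor_add_one (d - c j)
    linarith
  refine ⟨min (c i + 1) I, le_min (by linarith) (by linarith), ?_, ?_⟩
  · intro x hx
    obtain ⟨t, h1, h2⟩ := (mem_Arc_iff _ _ _).1 hx
    -- reduce to the first lap
    have h3 := Int.floor_le (x + t - c i)
    have h4 := Int.lt_floor_add_one (x + t - c i)
    have h5 : 0 ≤ ⌊x + t - c i⌋ := Int.floor_nonneg.2 (by linarith)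
    have h5' : (0:ℝ) ≤ ⌊x + t - c i⌋ := by exact_mod_cast h5
    set f := ⌊x + t - c i⌋
    have h6 : ⌈c i - x⌉ ≤ t - f := by rw [Int.ceil_le]; push_cast; linarith
    have h7 : t - f < ⌈min (c i + 1) I - x⌉ := by
      rw [Int.lt_ceil, lt_sub_iff_add_lt, lt_min_iff]
      push_cast
      constructor <;> linarith
    omega
  · intro j
    have h1 : ⌈min (c i + 1) I - c j⌉ ≤ ⌈c i - c j⌉ + 1 := by
      rw [Int.ceil_le]
      have := Int.le_ceil (c i - c j)
      have := min_le_left (c i + 1) I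
      push_cast
      linarith
    split_ifs with hmem
    · omega
    · by_contra hcon
      apply hmem
      rw [mem_Arc_iff]
      refine ⟨⌈c i - c j⌉, by linarith [Int.le_ceil (c i - c j)], ?_⟩
      have h2 : ⌈c i - c j⌉ < ⌈min (c i + 1) I - c j⌉ := by omega
      rw [Int.lt_ceil, lt_sub_iff_add_lt, lt_min_iff] at h2
      by_contra hgt
      push Not at hgt
      have h3 : ⌊d - c j⌋ < ⌈c i - c j⌉ := by
        rw [Int.floor_lt]; linarith
      have h4 : (⌊d - c j⌋ : ℝ) + 1 ≤ ⌈c i - c j⌉ := by exact_mod_cast h3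
      linarith [hI j, h2.2]

theorem circular {N : ℕ} (c d : Fin N → ℝ) (v m ω : ℕ)
    (hω : ∀ θ : AddCircle (1:ℝ), (Finset.univ.filter fun i => θ ∈ Arc (c i) (d i)).card ≤ ω)
    (hm : m * ω ≤ N * v) (hmN : m ≤ N) :
    ∃ T : Finset (Fin N), T.card = m ∧
      ∀ θ : AddCircle (1:ℝ), (T.filter fun i => θ ∈ Arc (c i) (d i)).card ≤ v := by
  rcases Nat.eq_zero_or_pos N with rfl | hN
  · exact ⟨∅, by simp; omega, by simp⟩
  choose D hD1 hD2 hD3 using fun i => end_exists c i (d i)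
  obtain ⟨τ, e, hτ, he⟩ := matching_exists hN c D ω (by
    intro j
    refine (Finset.sum_le_sum fun i _ => hD3 i j).trans ?_
    rw [← Finset.sum_filter, Finset.sum_const, nsmul_eq_mul, mul_one]
    exact_mod_cast hω (c j))
  obtain ⟨T, -, hT, hTx⟩ := selection τ e c (fun i => (hD1 i).trans (hτ i)) _ Finset.univ rfl
    (fun i _ => Finset.mem_univ _) v m (by positivity)
    (by rw [he, Finset.card_univ, Fintype.card_fin]; exact_mod_cast hm)
    (by simpa using hmN)
  refine ⟨T, hT, ?_⟩
  intro θ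
  obtain ⟨x, rfl⟩ := QuotientAddGroup.mk_surjective θ
  have h1 := hTx x
  have h2 : ∑ i ∈ T, (if ((x : ℝ) : AddCircle (1:ℝ)) ∈ Arc (c i) (d i) then (1:ℤ) else 0)
      ≤ ∑ i ∈ T, (⌈c (τ i) + e i - x⌉ - ⌈c i - x⌉) := by
    apply Finset.sum_le_sum
    intro i _
    have hmono : ⌈D i - x⌉ ≤ ⌈c (τ i) + e i - x⌉ := Int.ceil_mono (by linarith [hτ i])
    split_ifs with hmem
    · have := hD2 i x hmem
      omega
    · have : ⌈c i - x⌉ ≤ ⌈D i - x⌉ := Int.ceil_mono (by linarith [hD1 i])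
      omega
  rw [← Finset.sum_filter, Finset.sum_const, nsmul_eq_mul, mul_one] at h2
  exact_mod_cast h2.trans h1

theorem color_intervals {n : ℕ} (a b : Fin n → ℝ) (ω : ℕ) (hω0 : 0 < ω)
    (hω : ∀ x : ℝ, (Finset.univ.filter fun i => x ∈ Set.Icc (a i) (b i)).card ≤ ω)
    (S : Finset (Fin n)) :
    ∃ col : Fin n → Fin ω, ∀ i ∈ S, ∀ j ∈ S, i ≠ j → ∀ x, x ∈ Set.Icc (a i) (b i) →
      x ∈ Set.Icc (a j) (b j) → col i ≠ col j := by
  induction S using Finset.induction_on_max_value a with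
  | empty => exact ⟨fun _ => ⟨0, hω0⟩, by simp⟩
  | insert p s hp hmax ih =>
    obtain ⟨col, hcol⟩ := ih
    -- neighbours of p all contain a p
    let U := (s.filter fun i => a p ∈ Set.Icc (a i) (b i))
    have hex : ∃ q : Fin ω, a p ≤ b p → q ∉ U.image col := by
      by_cases hab : a p ≤ b p
      · have : (U.image col).card < (Finset.univ : Finset (Fin ω)).card := by
          rw [Finset.card_univ, Fintype.card_fin]
          refine Finset.card_image_le.trans_lt (lt_of_lt_of_le ?_ (hω (a p)))
          apply Finset.card_lt_card
          refine Finset.ssubset_iff_of_subset ?_ |>.2 ⟨p, by simp [hab], by simp [U, hp]⟩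
          intro i hi
          simp only [U, Finset.mem_filter] at hi
          simpa using hi.2
        obtain ⟨q, _, hq⟩ := Finset.exists_mem_notMem_of_card_lt_card this
        exact ⟨q, fun _ => hq⟩
      · exact ⟨⟨0, hω0⟩, fun h => absurd h hab⟩
    obtain ⟨q, hq⟩ := hex
    have key : ∀ i ∈ s, ∀ x, x ∈ Set.Icc (a i) (b i) → x ∈ Set.Icc (a p) (b p) → col i ≠ q := by
      intro i hi x hxi hxp h
      apply hq (hxp.1.trans hxp.2)
      rw [← h]
      apply Finset.mem_image_of_mem
      simp only [U, Finset.mem_filter]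
      exact ⟨hi, hmax i hi, hxp.1.trans hxi.2⟩
    refine ⟨Function.update col p q, ?_⟩
    intro i hi j hj hij x hxi hxj
    rw [Finset.mem_insert] at hi hj
    by_cases hip : i = p
    · subst hip
      have hj' : j ∈ s := hj.resolve_left (Ne.symm hij)
      rw [Function.update_self, Function.update_of_ne (Ne.symm hij)]
      exact (key j hj' x hxj hxi).symm
    · have hi' := hi.resolve_left hip
      by_cases hjp : j = p
      · subst hjp
        rw [Function.update_self, Function.update_of_ne hij]
        exact key i hi' x hxi hxj
      · rw [Function.update_of_ne hip, Function.update_of_ne hjp]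
        exact hcol i hi' j (hj.resolve_left hjp) hij x hxi hxj

theorem heavy_subset {ω : ℕ} (f : Fin ω → ℕ) (g : ℕ) : ∀ v : ℕ, v + g = ω →
    ∃ K : Finset (Fin ω), K.card = v ∧ v * ∑ i, f i ≤ ω * ∑ i ∈ K, f i := by
  induction g with
  | zero =>
    intro v hv
    exact ⟨Finset.univ, by simp; omega, by rw [show v = ω by omega]⟩
  | succ g ih =>
    intro v hv
    obtain ⟨K, hK, hKs⟩ := ih (v + 1) (by omega)
    have hne : K.Nonempty := Finset.card_pos.1 (by omega)
    obtain ⟨y, hy, hmin⟩ := Finset.exists_min_image K f hne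
    refine ⟨K.erase y, by rw [Finset.card_erase_of_mem hy]; omega, ?_⟩
    have h1 : (v + 1) * f y ≤ ∑ i ∈ K, f i := by
      have := Finset.card_nsmul_le_sum K f (f y) hmin
      rwa [hK, smul_eq_mul] at this
    have h2 := Finset.sum_erase_add K f hy
    generalize ∑ i ∈ K.erase y, f i = E at *
    have h3 : v * f y ≤ E := by rw [← h2] at h1; linarith
    rw [← h2] at hKs
    have : (v + 1) * (v * ∑ i, f i) ≤ (v + 1) * (ω * E) := by
      calc (v + 1) * (v * ∑ i, f i) = v * ((v + 1) * ∑ i, f i) := by ring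
        _ ≤ v * (ω * (E + f y)) := Nat.mul_le_mul_left _ hKs
        _ = ω * (v * E) + ω * (v * f y) := by ring
        _ ≤ ω * (v * E) + ω * E := by gcongr
        _ = (v + 1) * (ω * E) := by ring
    exact Nat.le_of_mul_le_mul_left this (by omega)

theorem linear_bound {n : ℕ} (a b : Fin n → ℝ) (k m : ℕ) (hk : 2 ≤ k) (hmn : m ≤ n)
    (h : ∀ T : Finset (Fin n), T.card = m → ∃ T' ⊆ T, T'.card = k ∧
      ∃ x, ∀ i ∈ T', x ∈ Set.Icc (a i) (b i)) :
    ∃ x : ℝ, n * (k - 1) ≤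
      (Finset.univ.filter fun i => x ∈ Set.Icc (a i) (b i)).card * (m - 1) := by
  -- a point of maximal depth
  let dep : ℝ → ℕ := fun x => (Finset.univ.filter fun i => x ∈ Set.Icc (a i) (b i)).card
  have hle : ∀ x, dep x ≤ n := fun x => (Finset.card_le_univ _).trans (by simp)
  obtain ⟨x, hx⟩ : ∃ x, ∀ y, dep y ≤ dep x := by
    have hfin : (Set.range dep).Finite := (Set.finite_Iic n).subset (by
      rintro _ ⟨y, rfl⟩; exact hle y)
    obtain ⟨_, ⟨x, rfl⟩, hx⟩ := Set.exists_max_image _ id hfin ⟨_, Set.mem_range_self 0⟩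
    exact ⟨x, fun y => hx _ ⟨y, rfl⟩⟩
  refine ⟨x, ?_⟩
  by_contra hlt
  push Not at hlt
  change dep x * (m - 1) < _ at hlt
  obtain ⟨T₀, _, hT₀⟩ := Finset.exists_subset_card_eq (s := (Finset.univ : Finset (Fin n))) (n := m)
    (by simpa using hmn)
  obtain ⟨T', hT', hT'k, y, hy⟩ := h T₀ hT₀
  have hkdep : k ≤ dep x := by
    refine le_trans ?_ (hx y)
    rw [← hT'k]
    apply Finset.card_le_card
    intro i hi
    simpa using hy i hi
  generalize dep x = ω at *
  obtain ⟨col, hcol⟩ := color_intervals a b ω (by omega) hx Finset.univ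
  obtain ⟨K, hK, hKs⟩ := heavy_subset (fun q => (Finset.univ.filter fun i => col i = q).card)
    (ω - (k - 1)) (k - 1) (by omega)
  have e1 : ∑ q, (Finset.univ.filter fun i => col i = q).card = n := by
    rw [← Finset.card_eq_sum_card_fiberwise (fun i _ => Finset.mem_univ _)]
    simp
  have e2 : ∑ q ∈ K, (Finset.univ.filter fun i => col i = q).card
      = (Finset.univ.filter fun i => col i ∈ K).card := by
    rw [Finset.card_eq_sum_card_fiberwise (f := col) (t := K) (fun i hi => by simpa using hi)]
    apply Finset.sum_congr rfl
    intro q hq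
    congr 1
    ext i
    simp only [Finset.mem_filter, Finset.mem_univ, true_and]
    constructor
    · rintro rfl; exact ⟨hq, rfl⟩
    · exact fun h => h.2
  rw [e1, e2] at hKs
  have hbig : m ≤ (Finset.univ.filter fun i => col i ∈ K).card := by
    have : ω * (m - 1) < ω * (Finset.univ.filter fun i => col i ∈ K).card := by
      refine hlt.trans_le ?_
      rw [mul_comm]; exact hKs
    have := Nat.lt_of_mul_lt_mul_left this
    omega
  obtain ⟨T, hT, hTc⟩ := Finset.exists_subset_card_eq hbig
  obtain ⟨R, hR, hRk, z, hz⟩ := h T hTc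
  obtain ⟨i, hi, j, hj, hij, hc⟩ := Finset.exists_ne_map_eq_of_card_lt_of_maps_to
    (s := R) (t := K) (f := col) (by omega) (by
      intro i hi
      have := hT (hR hi)
      simpa using this)
  exact hcol i (Finset.mem_univ _) j (Finset.mem_univ _) hij z (hz i hi) (hz j hj) hc

/-- The cylindrical case of the product society bound: in a (k,m)-agreeable cylindrical
society with `n ≥ m(m-1)/(k-1)` voters, some point of the cylinder lies in strictly more
than `(k-1)²/(m(m-1))·n` of the approval sets. -/
theorem cylindrical_product_bound (k m n : ℕ) (hk : 2 ≤ k) (hkm : k ≤ m)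
    (a b c d : Fin n → ℝ)
    (h : ∀ T : Finset (Fin n), T.card = m → ∃ T' ⊆ T, T'.card = k ∧
      (⋂ i ∈ T', Set.Icc (a i) (b i) ×ˢ Arc (c i) (d i)).Nonempty)
    (hn : ((m : ℚ) * (m - 1)) / ((k : ℚ) - 1) ≤ n) :
    ∃ z : ℝ × AddCircle (1 : ℝ), (((k : ℚ) - 1) ^ 2 / ((m : ℚ) * (m - 1))) * n <
      ((Finset.univ.filter fun i : Fin n =>
        z ∈ Set.Icc (a i) (b i) ×ˢ Arc (c i) (d i)).card : ℚ) := by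
  have hm2 : 2 ≤ m := hk.trans hkm
  have hkq : (0:ℚ) < (k:ℚ) - 1 := by
    have : (2:ℚ) ≤ k := by exact_mod_cast hk
    linarith
  have hmq : (0:ℚ) < (m:ℚ) - 1 := by
    have : (2:ℚ) ≤ m := by exact_mod_cast hm2
    linarith
  have hkmq : (k:ℚ) ≤ m := by exact_mod_cast hkm
  rw [div_le_iff₀ hkq] at hn
  have hmn : m ≤ n := by
    have : (m:ℚ) * (m - 1) ≤ n * (m - 1) :=
      hn.trans (mul_le_mul_of_nonneg_left (by linarith) (by positivity))
    exact_mod_cast le_of_mul_le_mul_right this hmq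
  have h' : ∀ T : Finset (Fin n), T.card = m → ∃ T' ⊆ T, T'.card = k ∧
      ∃ z : ℝ × AddCircle (1:ℝ), ∀ i ∈ T', z.1 ∈ Set.Icc (a i) (b i) ∧ z.2 ∈ Arc (c i) (d i) := by
    intro T hT
    obtain ⟨T', h1, h2, z, hz⟩ := h T hT
    refine ⟨T', h1, h2, z, ?_⟩
    intro i hi
    have := Set.mem_iInter₂.1 hz i hi
    exact Set.mem_prod.1 this
  obtain ⟨x, hx⟩ := linear_bound a b k m hk hmn (by
    intro T hT
    obtain ⟨T', h1, h2, z, hz⟩ := h' T hT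
    exact ⟨T', h1, h2, z.1, fun i hi => (hz i hi).1⟩)
  set S := (Finset.univ.filter fun i => x ∈ Set.Icc (a i) (b i)) with hS
  have hxq : (n:ℚ) * (k - 1) ≤ S.card * (m - 1) := by
    have : ((n * (k - 1) : ℕ) : ℚ) ≤ ((S.card * (m - 1) : ℕ) : ℚ) := by exact_mod_cast hx
    rw [Nat.cast_mul, Nat.cast_mul, Nat.cast_sub (by omega), Nat.cast_sub (by omega)] at this
    simpa using this
  have hmS : m ≤ S.card := by
    have : (m:ℚ) * (m - 1) ≤ S.card * (m - 1) := hn.trans hxq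
    exact_mod_cast le_of_mul_le_mul_right this hmq
  by_contra hcon
  push Not at hcon
  let φ := S.orderEmbOfFin rfl
  have hφ : ∀ i, φ i ∈ S := fun i => S.orderEmbOfFin_mem rfl i
  have hcard : ∀ θ : AddCircle (1:ℝ),
      (Finset.univ.filter fun i => θ ∈ Arc (c (φ i)) (d (φ i))).card ≤
      (Finset.univ.filter fun i : Fin n => (x, θ) ∈ Set.Icc (a i) (b i) ×ˢ Arc (c i) (d i)).card := by
    intro θ
    apply Finset.card_le_card_of_injOn φ
    · intro i hi
      have h1 := hφ i
      replace h1 := (Finset.mem_filter.1 h1).2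
      simp only [Finset.coe_filter, Finset.mem_univ, true_and, Set.mem_ofPred_eq] at hi ⊢
      exact Set.mem_prod.2 ⟨h1, hi⟩
    · exact φ.injective.injOn
  -- maximal depth on the circle
  have hfloor : ∀ θ : AddCircle (1:ℝ),
      (Finset.univ.filter fun i => θ ∈ Arc (c (φ i)) (d (φ i))).card ≤ S.card * (k - 1) / m := by
    intro θ
    rw [Nat.le_div_iff_mul_le (by omega)]
    have h1 := hcon (x, θ)
    have h2 : ((Finset.univ.filter fun i => θ ∈ Arc (c (φ i)) (d (φ i))).card : ℚ) ≤ _ :=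
      (Nat.cast_le.2 (hcard θ)).trans h1
    have hmpos : (0:ℚ) < m := by linarith
    have h3 : ((k:ℚ) - 1) ^ 2 / ((m:ℚ) * (m - 1)) * n * m ≤ S.card * (k - 1) := by
      have : ((k:ℚ) - 1) ^ 2 / ((m:ℚ) * (m - 1)) * n * m
          = (n * (k - 1)) / (m - 1) * (k - 1) := by
        field_simp
      rw [this]
      apply mul_le_mul_of_nonneg_right _ hkq.le
      rw [div_le_iff₀ hmq]; exact hxq
    have h4 := (mul_le_mul_of_nonneg_right h2 hmpos.le).trans h3
    have h5 : ((S.card * (k - 1) : ℕ) : ℚ) = S.card * ((k:ℚ) - 1) := by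
      rw [Nat.cast_mul, Nat.cast_sub (by omega)]; simp
    rw [← h5] at h4
    exact_mod_cast h4
  obtain ⟨T, hT, hTθ⟩ := circular (fun i => c (φ i)) (fun i => d (φ i)) (k - 1) m _ hfloor
    (Nat.mul_div_le _ _) hmS
  obtain ⟨T', hT', hk', z, hz⟩ := h' (T.map φ.toEmbedding) (by rw [Finset.card_map, hT])
  have hfin : T'.card ≤ (T.filter fun i => z.2 ∈ Arc (c (φ i)) (d (φ i))).card := by
    rw [← Finset.card_map φ.toEmbedding]
    apply Finset.card_le_card
    intro i hi
    obtain ⟨j, hj, rfl⟩ := Finset.mem_map.1 (hT' hi)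
    apply Finset.mem_map_of_mem
    rw [Finset.mem_filter]
    exact ⟨hj, (hz _ hi).2⟩
  have := hTθ z.2
  omega
end

section
/- Let 2 ≤ k ≤ m and let C_1, ..., C_n be subsets of the torus (ℝ/ℤ) × (ℝ/ℤ) of the form J_i × K_i where J_i and K_i are closed arcs, such that among any m of them, some k share a common point. If n ≥ m²/(k-1), then there is a point of the torus contained in strictly more than (k-1)²/m² · n of the sets C_i. -/
open Classical

/-- cyclic distance going back from `r` to `j` -/
def cycD {N : ℕ} (r j : Fin (N+1)) : ℕ :=
  if j.val ≤ r.val then r.val - j.val else r.val + (N+1) - j.val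

lemma cycD_lt {N : ℕ} (r j : Fin (N+1)) : cycD r j < N+1 := by
  unfold cycD; split_ifs <;> omega

lemma fin_succ_val {N : ℕ} (r : Fin (N+1)) :
    (r.val = N ∧ (r+1).val = 0) ∨ (r.val < N ∧ (r+1).val = r.val + 1) := by
  rw [Fin.val_add_one]
  have := r.isLt
  split_ifs with h
  · left; subst h; simp
  · right
    have : r.val ≠ N := fun h' => h (Fin.ext (by simpa using h'))
    omega

lemma sum_two {N : ℕ} (f : Fin (N+1) → ℕ) (u v : Fin (N+1)) (huv : u ≠ v) :
    ∑ r, f r = f u + f v + ∑ r ∈ (Finset.univ.erase u).erase v, f r := by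
  rw [← Finset.add_sum_erase Finset.univ f (Finset.mem_univ u),
    ← Finset.add_sum_erase (Finset.univ.erase u) f
      (Finset.mem_erase.2 ⟨huv.symm, Finset.mem_univ v⟩)]
  ring

lemma sum_two_le {N : ℕ} (f g : Fin (N+1) → ℕ) (u v : Fin (N+1)) (huv : u ≠ v)
    (h : ∀ r, r ≠ u → r ≠ v → f r = g r) (h2 : f u + f v ≤ g u + g v) :
    ∑ r, f r ≤ ∑ r, g r := by
  rw [sum_two f u v huv, sum_two g u v huv]
  have : ∑ r ∈ (Finset.univ.erase u).erase v, f r = ∑ r ∈ (Finset.univ.erase u).erase v, g r := by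
    apply Finset.sum_congr rfl
    intro r hr
    simp only [Finset.mem_erase] at hr
    exact h r hr.2.1 hr.1
  omega

lemma sum_two_lt {N : ℕ} (f g : Fin (N+1) → ℕ) (u v : Fin (N+1)) (huv : u ≠ v)
    (h : ∀ r, r ≠ u → r ≠ v → f r = g r) (h2 : f u + f v < g u + g v) :
    ∑ r, f r < ∑ r, g r := by
  rw [sum_two f u v huv, sum_two g u v huv]
  have : ∑ r ∈ (Finset.univ.erase u).erase v, f r = ∑ r ∈ (Finset.univ.erase u).erase v, g r := by
    apply Finset.sum_congr rfl
    intro r hr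
    simp only [Finset.mem_erase] at hr
    exact h r hr.2.1 hr.1
  omega

/-- uniform sampling -/
lemma sample_exists {N : ℕ} (m s p : ℕ) (hm : 0 < m) (hmn : m ≤ N+1) (hp : m * p ≤ s * (N+1)) :
    ∃ A : Finset (Fin (N+1)), A.card = m ∧
      ∀ j, (A.filter fun r => cycD r j < p).card ≤ s := by
  have hlt : ∀ t : Fin m, t.val * (N+1) / m < N+1 := by
    intro t
    rw [Nat.div_lt_iff_lt_mul hm, mul_comm]
    exact Nat.mul_lt_mul_of_pos_left t.isLt (by omega)
  let g : Fin m → Fin (N+1) := fun t => ⟨t.val * (N+1) / m, hlt t⟩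
  have hmono : ∀ x y : Fin m, x < y → g x < g y := by
    intro x y hxy
    show x.val * (N+1) / m < y.val * (N+1) / m
    have h1 : x.val * (N+1) + m ≤ y.val * (N+1) := by
      have : x.val + 1 ≤ y.val := hxy
      nlinarith
    have h2 := Nat.div_le_div_right (c := m) h1
    rw [Nat.add_div_right _ hm] at h2
    omega
  have hinj : Function.Injective g := (show StrictMono g from fun x y => hmono x y).injective
  refine ⟨Finset.univ.image g, by rw [Finset.card_image_of_injective _ hinj]; simp, ?_⟩
  intro j
  rw [Finset.filter_image, Finset.card_image_of_injective _ hinj]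
  obtain ⟨c, hc1, hc2⟩ : ∃ c, j.val * m ≤ c * (N+1) ∧ ∀ u, j.val * m ≤ u * (N+1) → c ≤ u := by
    have hex : ∃ c, j.val * m ≤ c * (N+1) := ⟨j.val * m, by nlinarith [Nat.zero_le (j.val * m)]⟩
    exact ⟨Nat.find hex, Nat.find_spec hex, fun u hu => Nat.find_min' hex hu⟩
  have key : ∀ t : Fin m, cycD (g t) j < p →
      (if j.val ≤ (g t).val then t.val else t.val + m) ∈ Finset.Ico c (c+s) := by
    intro t ht
    have hg1 : (g t).val * m ≤ t.val * (N+1) := Nat.div_mul_le_self _ _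
    have hg2 : t.val * (N+1) < ((g t).val + 1) * m := by
      have := Nat.lt_div_mul_add (a := t.val * (N+1)) hm
      show t.val * (N+1) < (t.val * (N+1) / m + 1) * m
      rw [add_mul]; omega
    have hj := j.isLt
    unfold cycD at ht
    rw [Finset.mem_Ico]
    split_ifs at ht ⊢ with hle
    · refine ⟨hc2 _ (le_trans (Nat.mul_le_mul_right _ hle) hg1), ?_⟩
      have h3 : (g t).val + 1 ≤ j.val + p := by omega
      have h4 := Nat.mul_le_mul_right m h3
      by_contra hcon
      push Not at hcon
      have := Nat.mul_le_mul_right (N+1) hcon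
      nlinarith
    · have h3 : (g t).val + (N+1) + 1 ≤ j.val + p := by omega
      have h4 := Nat.mul_le_mul_right m h3
      refine ⟨hc2 _ ?_, ?_⟩
      · have := Nat.mul_le_mul_right m hj.le
        nlinarith
      · by_contra hcon
        push Not at hcon
        have := Nat.mul_le_mul_right (N+1) hcon
        nlinarith
  have := Finset.card_le_card_of_injOn
    (s := Finset.univ.filter fun t : Fin m => cycD (g t) j < p) (t := Finset.Ico c (c+s))
    (fun t : Fin m => if j.val ≤ (g t).val then t.val else t.val + m)
    (fun t ht => key t (by simpa using ht))
    (by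
      intro x _ y _ hxy
      have hx := x.isLt
      have hy := y.isLt
      apply Fin.ext
      dsimp only at hxy
      split_ifs at hxy <;> omega)
  simpa using this

lemma ell_chain {N : ℕ} (l : Fin (N+1) → ℕ) (h : ∀ r, l (r+1) ≤ l r + 1) :
    ∀ d, ∀ r r', cycD r r' = d → l r ≤ l r' + d := by
  intro d
  induction d with
  | zero =>
    intro r r' h0
    have : r = r' := by
      apply Fin.ext
      have := r.isLt
      have := r'.isLt
      unfold cycD at h0
      split_ifs at h0 <;> omega
    subst this; omega
  | succ d ih =>
    intro r r' h0
    have h1 := h r'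
    have h2 : cycD r (r'+1) = d := by
      have := r.isLt
      have := r'.isLt
      have := fin_succ_val r'
      unfold cycD at h0 ⊢
      split_ifs at h0 ⊢ <;> omega
    have := ih r (r'+1) h2
    omega

lemma ell_le {N : ℕ} (l : Fin (N+1) → ℕ) (hl : ∀ r, l r ≤ N+1)
    (h : ∀ r, l (r+1) ≤ l r + 1) (p : ℕ)
    (hp : ∀ j, (∑ r, if cycD r j < l r then 1 else 0) ≤ p) (r : Fin (N+1)) : l r ≤ p := by
  rcases Nat.eq_zero_or_pos (l r) with h0 | hpos
  · omega
  have hr := r.isLt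
  have hlr := hl r
  let bk : ℕ → Fin (N+1) := fun e => if he : e < N+1 then
    (if her : e ≤ r.val then ⟨r.val - e, by omega⟩ else ⟨r.val + (N+1) - e, by
      omega⟩) else 0
  have hbk : ∀ e, e < N+1 → ((e ≤ r.val ∧ (bk e).val = r.val - e) ∨
      (r.val < e ∧ (bk e).val = r.val + (N+1) - e)) := by
    intro e he
    simp only [bk, he, dif_pos]
    split_ifs with h1
    · left; exact ⟨h1, rfl⟩
    · right; exact ⟨by omega, rfl⟩
  refine le_trans ?_ (hp (bk (l r - 1)))
  rw [← Finset.card_filter]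
  have := Finset.card_le_card_of_injOn (s := Finset.range (l r))
    (t := Finset.univ.filter fun r' => cycD r' (bk (l r - 1)) < l r') bk
    (by
      intro e he
      have he : e < l r := by simpa using he
      have h1 := hbk e (by omega)
      have h2 := hbk (l r - 1) (by omega)
      have h3 : cycD r (bk e) = e := by
        unfold cycD; split_ifs <;> omega
      have h4 : cycD (bk e) (bk (l r - 1)) = l r - 1 - e := by
        unfold cycD; split_ifs <;> omega
      have h5 := ell_chain l h e r (bk e) h3
      simp only [Finset.coe_filter, Finset.mem_univ, true_and, Set.mem_ofPred_eq]
      omega)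
    (by
      intro x hx y hy hxy
      have hx : x < l r := by simpa using hx
      have hy : y < l r := by simpa using hy
      have h1 := hbk x (by omega)
      have h2 := hbk y (by omega)
      rw [hxy] at h1
      omega)
  simpa using this

/-- the discrete selection lemma, proved by uncrossing nested arcs -/
lemma discrete_select {N : ℕ} (m s p : ℕ) (hm : 0 < m) (hmn : m ≤ N+1)
    (hps : m * p ≤ s * (N+1)) (M : ℕ) :
    ∀ l : Fin (N+1) → ℕ, (∑ r, l r ^ 2 = M) → (∀ r, l r ≤ N+1) →
    (∀ j, (∑ r, if cycD r j < l r then 1 else 0) ≤ p) →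
    ∃ A : Finset (Fin (N+1)), A.card = m ∧
      ∀ j, (∑ r, if r ∈ A ∧ cycD r j < l r then 1 else 0) ≤ s := by
  induction M using Nat.strong_induction_on with
  | _ M ih =>
  intro l hM hl hp
  by_cases hfin : ∀ r, l (r+1) ≤ l r + 1
  · obtain ⟨A, hA, hA2⟩ := sample_exists (N := N) m s p hm hmn hps
    refine ⟨A, hA, fun j => le_trans ?_ (hA2 j)⟩
    rw [← Finset.card_filter]
    apply Finset.card_le_card
    intro r hr
    simp only [Finset.mem_filter, Finset.mem_univ, true_and] at hr ⊢
    exact ⟨hr.1, lt_of_lt_of_le hr.2 (ell_le l hl hfin p hp r)⟩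
  · push Not at hfin
    obtain ⟨u, hu⟩ := hfin
    obtain ⟨v, hv⟩ : ∃ v, v = u + 1 := ⟨_, rfl⟩
    rw [← hv] at hu
    have huv : u ≠ v := by rintro rfl; omega
    have hval := fin_succ_val u
    rw [← hv] at hval
    have huv' : u.val ≠ v.val := fun h => huv (Fin.ext h)
    let l' : Fin (N+1) → ℕ := Function.update (Function.update l u (l v - 1)) v (l u + 1)
    have hl'v : l' v = l u + 1 := by simp [l']
    have hl'u : l' u = l v - 1 := by simp [l', Function.update_of_ne huv]
    have hl'o : ∀ r, r ≠ u → r ≠ v → l' r = l r := by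
      intro r h1 h2; simp [l', Function.update_of_ne h1, Function.update_of_ne h2]
    have hlu := hl u
    have hlv := hl v
    have hDs : ∀ j : Fin (N+1), (j = v ∧ cycD u j = N ∧ cycD v j = 0) ∨
        (j ≠ v ∧ cycD v j = cycD u j + 1) := by
      intro j
      have := u.isLt
      have := v.isLt
      have := j.isLt
      by_cases hjv : j = v
      · left
        subst hjv
        refine ⟨rfl, ?_, ?_⟩ <;> unfold cycD <;> split_ifs <;> omega
      · right
        refine ⟨hjv, ?_⟩
        have : j.val ≠ v.val := fun h => hjv (Fin.ext h)
        unfold cycD; split_ifs <;> omega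
    have hlt : ∑ r, l' r ^ 2 < M := by
      rw [← hM]
      apply sum_two_lt _ _ u v huv
      · intro r h1 h2; rw [hl'o r h1 h2]
      · rw [hl'u, hl'v]
        obtain ⟨e, he⟩ : ∃ e, l v = l u + 2 + e := ⟨l v - l u - 2, by omega⟩
        rw [he]
        have : l u + 2 + e - 1 = l u + 1 + e := by omega
        rw [this]
        nlinarith
    obtain ⟨A', hA', hA's⟩ := ih _ hlt l' rfl (by
        intro r
        by_cases h1 : r = u
        · subst h1; omega
        by_cases h2 : r = v
        · subst h2; omega
        rw [hl'o r h1 h2]; exact hl r) (by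
        intro j
        refine le_trans ?_ (hp j)
        apply sum_two_le _ _ u v huv
        · intro r h1 h2; rw [hl'o r h1 h2]
        · rw [hl'u, hl'v]
          rcases hDs j with ⟨_, h2, h3⟩ | ⟨_, h2⟩
          · rw [h2, h3]; split_ifs <;> omega
          · rw [h2]; split_ifs <;> omega)
    by_cases hc : v ∈ A' ∧ u ∉ A'
    · refine ⟨insert u (A'.erase v), ?_, ?_⟩
      · rw [Finset.card_insert_of_notMem (by simp [hc.2]), Finset.card_erase_of_mem hc.1]
        omega
      · intro j
        refine le_trans ?_ (hA's j)
        apply sum_two_le _ _ u v huv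
        · intro r h1 h2; simp [h1, h2, hl'o r h1 h2]
        · rw [hl'u, hl'v]
          simp only [Finset.mem_insert, Finset.mem_erase, hc.1, hc.2, huv.symm, true_or,
            true_and, false_and, ne_eq, not_true_eq_false, or_self, if_false]
          rcases hDs j with ⟨_, h2, h3⟩ | ⟨_, h2⟩
          · rw [h2, h3]; split_ifs <;> omega
          · rw [h2]; split_ifs <;> omega
    · refine ⟨A', hA', ?_⟩
      intro j
      refine le_trans ?_ (hA's j)
      apply sum_two_le _ _ u v huv
      · intro r h1 h2; simp [hl'o r h1 h2]
      · rw [hl'u, hl'v]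
        by_cases hvA : v ∈ A'
        · have huA : u ∈ A' := by tauto
          simp only [hvA, huA, true_and]
          rcases hDs j with ⟨_, h2, h3⟩ | ⟨_, h2⟩
          · rw [h2, h3]; split_ifs <;> omega
          · rw [h2]; split_ifs <;> omega
        · simp only [hvA, false_and, if_false]
          by_cases huA : u ∈ A'
          · simp only [huA, true_and]
            split_ifs <;> omega
          · simp [huA]

lemma coe_add_int_circle (y : ℝ) (z : ℤ) :
    ((y + z : ℝ) : AddCircle (1:ℝ)) = (y : AddCircle (1:ℝ)) := by
  have h0 : (((z:ℝ) : ℝ) : AddCircle (1:ℝ)) = 0 := by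
    rw [AddCircle.coe_eq_zero_iff]
    exact ⟨z, by simp⟩
  rw [AddCircle.coe_add, h0, add_zero]

lemma mem_Arc_iff_s8 (a b y : ℝ) :
    ((y : ℝ) : AddCircle (1:ℝ)) ∈ Arc a b ↔ ∃ z : ℤ, a ≤ y + z ∧ y + z ≤ b := by
  unfold Arc
  constructor
  · rintro ⟨t, ⟨h1, h2⟩, h3⟩
    have h3 : ((t : ℝ) : AddCircle (1:ℝ)) = y := h3
    have h4 : ((t - y : ℝ) : AddCircle (1:ℝ)) = 0 := by
      rw [AddCircle.coe_sub, h3, sub_self]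
    rw [AddCircle.coe_eq_zero_iff] at h4
    obtain ⟨z, hz⟩ := h4
    have hz : (z:ℝ) = t - y := by simpa using hz
    exact ⟨z, by linarith, by linarith⟩
  · rintro ⟨z, h1, h2⟩
    exact ⟨y + z, ⟨h1, h2⟩, coe_add_int_circle y z⟩

/-- points between `x` and the right end -/
lemma arc_seg (a b x y : ℝ) (hx0 : 0 ≤ x) (hx1 : x < 1) (hy0 : 0 ≤ y) (hy1 : y < 1)
    (hx : ((x : ℝ) : AddCircle (1:ℝ)) ∈ Arc a b)
    (h : (x ≤ y ∧ y ≤ Int.fract b) ∨ (Int.fract b < x ∧ (x ≤ y ∨ y ≤ Int.fract b))) :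
    ((y : ℝ) : AddCircle (1:ℝ)) ∈ Arc a b := by
  rw [mem_Arc_iff_s8] at hx ⊢
  obtain ⟨z, h1, h2⟩ := hx
  have hb := Int.fract_add_floor b
  have hb0 := Int.fract_nonneg b
  have hb1 := Int.fract_lt_one b
  generalize Int.fract b = β at *
  generalize ⌊b⌋ = w at *
  rcases h with ⟨h3, h4⟩ | ⟨h3, h4⟩
  · have hzw : z ≤ w := by
      have : (z:ℝ) < w + 1 := by linarith
      exact Int.lt_add_one_iff.1 (by exact_mod_cast this)
    have : (z:ℝ) ≤ w := by exact_mod_cast hzw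
    exact ⟨w, by linarith, by linarith⟩
  · have hzw : z + 1 ≤ w := by
      have : (z:ℝ) < w := by linarith
      exact_mod_cast this
    have hzw : (z:ℝ) + 1 ≤ w := by exact_mod_cast hzw
    rcases h4 with h4 | h4
    · exact ⟨w - 1, by push_cast; linarith, by push_cast; linarith⟩
    · exact ⟨w, by linarith, by linarith⟩

lemma circ_sorted {N : ℕ} (s m : ℕ) (a b : Fin (N+1) → ℝ) (hm : 0 < m) (hmn : m ≤ N+1)
    (hmono : Monotone fun i => Int.fract (b i))
    (h : ∀ T : Finset (Fin (N+1)), T.card = m → ∃ T' ⊆ T, T'.card = s+1 ∧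
      ∃ x, ∀ i ∈ T', x ∈ Arc (a i) (b i)) :
    ∃ x, s * (N+1) < m * (Finset.univ.filter fun i => x ∈ Arc (a i) (b i)).card := by
  by_contra hcon
  push Not at hcon
  let R : Fin (N+1) → AddCircle (1:ℝ) := fun i => ((Int.fract (b i) : ℝ) : AddCircle (1:ℝ))
  let Q : Fin (N+1) → ℕ → Prop := fun r q => ∀ j, cycD r j < q → R j ∈ Arc (a r) (b r)
  let l : Fin (N+1) → ℕ := fun r => Nat.findGreatest (Q r) (N+1)
  have hlQ : ∀ r, Q r (l r) := fun r =>
    Nat.findGreatest_spec (P := Q r) (Nat.zero_le _) (fun j hj => absurd hj (Nat.not_lt_zero _))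
  have hp : ∀ j, (∑ r, if cycD r j < l r then 1 else 0) ≤ s * (N+1) / m := by
    intro j
    rw [← Finset.card_filter, Nat.le_div_iff_mul_le hm, mul_comm]
    refine le_trans (Nat.mul_le_mul_left _ (Finset.card_le_card ?_)) (hcon (R j))
    intro r hr
    simp only [Finset.mem_filter, Finset.mem_univ, true_and] at hr ⊢
    exact hlQ r j hr
  obtain ⟨A, hA, hAs⟩ := discrete_select (N := N) m s _ hm hmn (Nat.mul_div_le _ _) _ l rfl
    (fun r => Nat.findGreatest_le _) hp
  obtain ⟨T', hT', hcard, x, hx⟩ := h A hA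
  obtain ⟨y, hyx⟩ : ∃ y : ℝ, (y : AddCircle (1:ℝ)) = x := QuotientAddGroup.mk_surjective x
  obtain ⟨x0, hx00, hx01, rfl⟩ : ∃ x0 : ℝ, 0 ≤ x0 ∧ x0 < 1 ∧ (x0 : AddCircle (1:ℝ)) = x := by
    refine ⟨Int.fract y, Int.fract_nonneg y, Int.fract_lt_one y, ?_⟩
    rw [← hyx, ← coe_add_int_circle (Int.fract y) ⌊y⌋, Int.fract_add_floor]
  obtain ⟨j, hj⟩ : ∃ j : Fin (N+1), (x0 ≤ Int.fract (b j) ∧ ∀ i, i < j → Int.fract (b i) < x0) ∨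
      (j = 0 ∧ ∀ i, Int.fract (b i) < x0) := by
    by_cases hex : ∃ i, x0 ≤ Int.fract (b i)
    · obtain ⟨i0, hi0⟩ := hex
      have hne : (Finset.univ.filter fun i => x0 ≤ Int.fract (b i)).Nonempty := ⟨i0, by simpa⟩
      refine ⟨Finset.min' _ hne, Or.inl ⟨?_, ?_⟩⟩
      · simpa using Finset.min'_mem _ hne
      · intro i hi
        by_contra hc
        push Not at hc
        exact absurd (Finset.min'_le _ i (by simpa using hc)) (not_le.2 hi)
    · push Not at hex
      exact ⟨0, Or.inr ⟨rfl, hex⟩⟩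
  have hcov : ∀ r ∈ T', cycD r j < l r := by
    intro r hr
    have hxr := hx r hr
    refine Nat.lt_of_succ_le (Nat.le_findGreatest (cycD_lt r j) ?_)
    intro i hi
    apply arc_seg _ _ x0 _ hx00 hx01 (Int.fract_nonneg _) (Int.fract_lt_one _) hxr
    have hir : cycD r i ≤ cycD r j := by omega
    have hi' := i.isLt
    have hj' := j.isLt
    have hr' := r.isLt
    rcases hj with ⟨hj1, hj2⟩ | ⟨rfl, hj2⟩
    · by_cases hrj : j ≤ r
      · left
        have hh : j ≤ i ∧ i ≤ r := by
          rw [Fin.le_def] at *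
          unfold cycD at hir
          split_ifs at hir <;> omega
        exact ⟨le_trans hj1 (hmono hh.1), hmono hh.2⟩
      · right
        refine ⟨hj2 r (not_le.1 hrj), ?_⟩
        have hh : j ≤ i ∨ i ≤ r := by
          rw [Fin.le_def] at *
          rw [Fin.le_def]
          unfold cycD at hir
          split_ifs at hir <;> omega
        rcases hh with hh | hh
        · left; exact le_trans hj1 (hmono hh)
        · right; exact hmono hh
    · right
      refine ⟨hj2 r, Or.inr ?_⟩
      apply hmono
      rw [Fin.le_def]
      unfold cycD at hir
      simp only [Fin.val_zero, Nat.zero_le, if_true] at hir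
      split_ifs at hir <;> omega
  have h1 := hAs j
  rw [← Finset.card_filter] at h1
  have h2 : T'.card ≤ (Finset.univ.filter fun r => r ∈ A ∧ cycD r j < l r).card := by
    apply Finset.card_le_card
    intro r hr
    simp only [Finset.mem_filter, Finset.mem_univ, true_and]
    exact ⟨hT' hr, hcov r hr⟩
  omega

/-- the circular society bound for a general finite index set -/
lemma circ_bound {ι : Type} (S : Finset ι) (s m : ℕ) (a b : ι → ℝ) (hm : 0 < m)
    (hmn : m ≤ S.card)
    (h : ∀ T ⊆ S, T.card = m → ∃ T' ⊆ T, T'.card = s+1 ∧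
      ∃ x, ∀ i ∈ T', x ∈ Arc (a i) (b i)) :
    ∃ x, s * S.card < m * (S.filter fun i => x ∈ Arc (a i) (b i)).card := by
  obtain ⟨N, hN⟩ : ∃ N, S.card = N + 1 := ⟨S.card - 1, by omega⟩
  let e0 : Fin (N+1) ≃ S := (S.equivFinOfCardEq hN).symm
  let σ := Tuple.sort fun i => Int.fract (b (e0 i))
  let e : Fin (N+1) ↪ ι := ((σ.trans e0).toEmbedding).trans (Function.Embedding.subtype _)
  have he : ∀ i, e i ∈ S := fun i => (e0 (σ i)).2
  have hmap : Finset.univ.map e = S := by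
    apply Finset.eq_of_subset_of_card_le
    · intro i hi
      obtain ⟨j, _, rfl⟩ := Finset.mem_map.1 hi
      exact he j
    · simp [hN]
  obtain ⟨x, hx⟩ := circ_sorted (N := N) s m (a ∘ e) (b ∘ e) hm (by omega)
    (Tuple.monotone_sort fun i => Int.fract (b (e0 i))) (by
      intro T hT
      obtain ⟨T', h1, h2, x, hx⟩ := h (T.map e) (by
        intro i hi
        obtain ⟨j, _, rfl⟩ := Finset.mem_map.1 hi
        exact he j) (by simpa using hT)
      obtain ⟨U, hU, rfl⟩ := Finset.subset_map_iff.1 h1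
      refine ⟨U, hU, by simpa using h2, x, fun i hi => hx (e i) (Finset.mem_map_of_mem e hi)⟩)
  refine ⟨x, ?_⟩
  rw [hN]
  convert hx using 2
  conv_lhs => rw [← hmap, Finset.filter_map, Finset.card_map]
  rfl

/-- The toroidal case of the product society bound: in a (k,m)-agreeable toroidal society
with `n ≥ m²/(k-1)` voters, some point of the torus lies in strictly more than
`(k-1)²/m²·n` of the approval sets. -/
theorem toroidal_product_bound (k m n : ℕ) (hk : 2 ≤ k) (hkm : k ≤ m)
    (a b c d : Fin n → ℝ)
    (h : ∀ T : Finset (Fin n), T.card = m → ∃ T' ⊆ T, T'.card = k ∧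
      (⋂ i ∈ T', Arc (a i) (b i) ×ˢ Arc (c i) (d i)).Nonempty)
    (hn : ((m : ℚ) ^ 2) / ((k : ℚ) - 1) ≤ n) :
    ∃ z : AddCircle (1 : ℝ) × AddCircle (1 : ℝ), (((k : ℚ) - 1) ^ 2 / (m : ℚ) ^ 2) * n <
      ((Finset.univ.filter fun i : Fin n =>
        z ∈ Arc (a i) (b i) ×ˢ Arc (c i) (d i)).card : ℚ) := by
  obtain ⟨s, rfl⟩ : ∃ s, k = s + 1 := ⟨k - 1, by omega⟩
  have hs : 1 ≤ s := by omega
  have hm : 0 < m := by omega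
  have hsn : m ^ 2 ≤ s * n := by
    have hsq : (0:ℚ) < s := by exact_mod_cast hs
    have : ((s + 1 : ℕ) : ℚ) - 1 = s := by push_cast; ring
    rw [this, div_le_iff₀ hsq, mul_comm] at hn
    exact_mod_cast hn
  have hmn : m ≤ n := by nlinarith
  obtain ⟨x, hx⟩ := circ_bound (Finset.univ : Finset (Fin n)) s m a b hm (by simpa using hmn) (by
    intro T _ hT
    obtain ⟨T', h1, h2, z, hz⟩ := h T hT
    refine ⟨T', h1, h2, z.1, fun i hi => ?_⟩
    exact (Set.mem_iInter₂.1 hz i hi).1)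
  rw [Finset.card_univ, Fintype.card_fin] at hx
  obtain ⟨y, hy⟩ := circ_bound (Finset.univ.filter fun i => x ∈ Arc (a i) (b i)) s m c d hm
    (by nlinarith) (by
    intro T _ hT
    obtain ⟨T', h1, h2, z, hz⟩ := h T hT
    refine ⟨T', h1, h2, z.2, fun i hi => ?_⟩
    exact (Set.mem_iInter₂.1 hz i hi).2)
  refine ⟨(x, y), ?_⟩
  rw [Finset.filter_filter] at hy
  have heq : (Finset.univ.filter fun i : Fin n =>
        (x, y) ∈ Arc (a i) (b i) ×ˢ Arc (c i) (d i)) =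
      (Finset.univ.filter fun i : Fin n => x ∈ Arc (a i) (b i) ∧ y ∈ Arc (c i) (d i)) := by
    ext i; simp
  rw [heq]
  generalize (Finset.univ.filter fun i : Fin n =>
    x ∈ Arc (a i) (b i) ∧ y ∈ Arc (c i) (d i)).card = q at *
  generalize (Finset.univ.filter fun i : Fin n => x ∈ Arc (a i) (b i)).card = q1 at *
  have hfin : s ^ 2 * n < q * m ^ 2 := by nlinarith
  have : ((s + 1 : ℕ) : ℚ) - 1 = s := by push_cast; ring
  have hmq : (0:ℚ) < (m:ℚ)^2 := by positivity
  rw [this, div_mul_eq_mul_div, div_lt_iff₀ hmq]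
  exact_mod_cast hfin
end
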